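/- arXiv:2102.01967 — 3 statements merged into one kernel-verified Lean document; each statement's English description precedes it below -/
import Mathlib

section
/- Let p be an odd rational prime, r ≥ p an integer, and m ≠ 1 a squarefree rational integer with m^(p−1) ≡ 1 (mod p^(p+1)), such that F(x) = x^(p^r) − m is irreducible over ℚ. Let α be a complex root of F and K = ℚ(α). Then K is not monogenic. -/
open Polynomial NumberField

/-- A ring with more than `p` ideals whose quotient is `ℤ/p` is not generated by one element. -/
theorem adjoin_singleton_ne_top_of_primes {S ι : Type*} [CommRing S] [Fintype ι] {p : ℕ}
    (hp : 0 < p) (P : ι → Ideal S) (hinj : Function.Injective P) (hcard : p < Fintype.card ι)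
    (hover : ∀ i, (P i).comap (algebraMap ℤ S) = Ideal.span {(p : ℤ)})
    (hres : ∀ i x, ∃ c : ℤ, x - (c : S) ∈ P i) (θ : S) : Algebra.adjoin ℤ {θ} ≠ ⊤ := by
  intro hθ
  have : NeZero p := ⟨hp.ne'⟩
  have hmem (i : ι) (c : ℤ) : (c : S) ∈ P i ↔ (p : ℤ) ∣ c := by
    rw [← Ideal.mem_span_singleton, ← hover i, Ideal.mem_comap, eq_intCast]
  choose c hc using fun i ↦ hres i θ
  obtain ⟨i, j, hij, hcij⟩ := Fintype.exists_ne_map_eq_of_card_lt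
    (fun i ↦ (c i : ZMod p)) (by simpa [ZMod.card] using hcard)
  have key (k : ι) (d : ℤ) (hd : θ - (d : S) ∈ P k) (f : ℤ[X]) :
      aeval θ f ∈ P k ↔ (p : ℤ) ∣ f.eval d := by
    rw [← hmem k]
    have h1 : aeval θ f - ((f.eval d : ℤ) : S) ∈ P k := by
      have h2 : ((f.eval d : ℤ) : S) = aeval (d : S) f := by
        rw [← eq_intCast (algebraMap ℤ S) d, aeval_algebraMap_apply]; simp
      rw [h2]
      rw [← eval_map_algebraMap, ← eval_map_algebraMap]
      exact (P k).mem_of_dvd (sub_dvd_eval_sub _ _ _) hd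
    exact ⟨fun h ↦ by simpa using (P k).sub_mem h h1, fun h ↦ by simpa using (P k).add_mem h1 h⟩
  have hj : θ - (c i : S) ∈ P j := by
    have h3 : ((c j - c i : ℤ) : S) ∈ P j := by
      rw [hmem, ← ZMod.intCast_eq_intCast_iff_dvd_sub]
      exact hcij
    have := (P j).add_mem (hc j) h3
    push_cast at this
    simpa using this
  refine hij (hinj ?_)
  ext x
  have hx : x ∈ Algebra.adjoin ℤ {θ} := hθ ▸ Algebra.mem_top
  rw [Algebra.adjoin_singleton_eq_range_aeval] at hx
  obtain ⟨f, rfl⟩ := hx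
  exact (key i _ (hc i) f).trans (key j _ hj f).symm

/-- If lower bounds for the ramification indices of some primes over `I` already sum to the degree,
these primes have inertia degree one. -/
theorem inertiaDeg_eq_one_of_finrank_le_sum {S ι : Type*} [CommRing S] [IsDomain S]
    [Module.Free ℤ S] [Module.Finite ℤ S] [Fintype ι] (I : Ideal ℤ) [I.IsPrime]
    [Finite (I.primesOver S)]
    (P : ι → I.primesOver S) (hinj : Function.Injective P) (n : ι → ℕ) (hn : ∀ i, 0 < n i)
    (hram : ∀ i, n i ≤ (P i).1.ramificationIdx ℤ) (hsum : Module.finrank ℤ S ≤ ∑ i, n i) (i : ι) :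
    (P i).1.inertiaDeg ℤ = 1 := by
  classical
  have := Fintype.ofFinite (I.primesOver S)
  have hpos (i : ι) : 0 < (P i).1.inertiaDeg ℤ :=
    have := (P i).2.1
    Ideal.inertiaDeg_pos _ _
  by_contra hne
  have h1 : ∑ i, n i < ∑ i, (P i).1.ramificationIdx ℤ * (P i).1.inertiaDeg ℤ := by
    refine Finset.sum_lt_sum (fun j _ ↦ ?_) ⟨i, Finset.mem_univ i, ?_⟩
    · nlinarith [hpos j, hram j]
    · have := hpos i
      have : 2 ≤ (P i).1.inertiaDeg ℤ := by omega
      nlinarith [hn i, hram i]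
  have h2 := Finset.sum_le_univ_sum_of_nonneg (s := Finset.univ.map ⟨P, hinj⟩)
    (f := fun q : I.primesOver S ↦ q.1.ramificationIdx ℤ * q.1.inertiaDeg ℤ) (fun _ ↦ Nat.zero_le _)
  rw [Ideal.sum_ramification_inertia_eq_finrank, Finset.sum_map] at h2
  exact absurd (h1.trans_le h2) hsum.not_gt

theorem exists_int_sub_mem_of_inertiaDeg_eq_one {S : Type*} [CommRing S] (I : Ideal ℤ) [I.IsMaximal]
    (P : Ideal S) [P.IsMaximal] [P.LiesOver I] (h : P.inertiaDeg ℤ = 1) (x : S) :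
    ∃ c : ℤ, x - (c : S) ∈ P := by
  rw [Ideal.inertiaDeg_eq_of_isMaximal I P] at h
  let := Ideal.Quotient.field I
  have h1 := finrank_eq_one_iff_of_nonzero' (1 : S ⧸ P) one_ne_zero |>.mp h
    (Ideal.Quotient.mk P x)
  obtain ⟨c, hc⟩ := h1
  obtain ⟨c, rfl⟩ := Ideal.Quotient.mk_surjective c
  refine ⟨c, ?_⟩
  rw [← Ideal.Quotient.eq, ← hc, Algebra.smul_def, mul_one]
  simp

theorem strictMono_totient_prime_pow {p : ℕ} (hp : p.Prime) (hp3 : 3 ≤ p) :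
    StrictMono fun k ↦ (p ^ k).totient := by
  refine strictMono_nat_of_lt_succ fun k ↦ ?_
  rw [Nat.totient_prime_pow_succ hp]
  calc (p ^ k).totient ≤ p ^ k * 1 := by rw [mul_one]; exact Nat.totient_le _
    _ < p ^ k * (p - 1) := Nat.mul_lt_mul_of_pos_left (by omega) (pow_pos hp.pos k)

theorem sum_totient_prime_pow {p : ℕ} (hp : p.Prime) {r t : ℕ} (ht : t ≤ r) :
    ∑ i ∈ Finset.range t, (p ^ (r - i)).totient + p ^ (r - t) = p ^ r := by
  induction t with
  | zero => simp
  | succ t ih =>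
    rw [← ih (by omega), Finset.sum_range_succ, add_assoc]
    congr 1
    obtain ⟨k, hk⟩ : ∃ k, r - t = k + 1 := ⟨r - t - 1, by omega⟩
    rw [hk, show r - (t + 1) = k by omega, Nat.totient_prime_pow_succ hp]
    obtain ⟨q, rfl⟩ : ∃ q, p = q + 1 := ⟨p - 1, by have := hp.pos; omega⟩
    simp; ring

theorem sum_range_prime_pow {p : ℕ} (hp : p.Prime) (r : ℕ) (g h : ℕ → ℕ)
    (hg : ∀ i < r, ∀ u, u.Coprime p → g (p ^ i * u) = h i) :
    ∑ k ∈ Finset.range (p ^ r), g k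
      = g 0 + ∑ i ∈ Finset.range r, (p ^ (r - i)).totient * h i := by
  induction r generalizing g h with
  | zero => simp
  | succ r ih =>
    rw [Finset.sum_range_succ', ← add_assoc,
      ← Finset.sum_filter_add_sum_filter_not (Finset.range (p ^ (r + 1))) (fun k ↦ p ∣ k)]
    congr 1
    · have h1 := ih (fun k ↦ g (p * k)) (fun i ↦ h (i + 1)) fun i hi u hu ↦ by
        rw [← hg (i + 1) (by omega) u hu]; ring_nf
      simp only [mul_zero] at h1
      simp only [Nat.add_sub_add_right]
      rw [← h1]
      symm
      refine Finset.sum_nbij (fun k ↦ p * k) ?_ ?_ ?_ (fun _ _ ↦ rfl)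
      · intro k hk
        simp only [Finset.mem_filter, Finset.mem_range] at hk ⊢
        exact ⟨by rw [pow_succ']; exact Nat.mul_lt_mul_of_pos_left hk hp.pos, dvd_mul_right _ _⟩
      · intro x _ y _ hxy
        exact Nat.eq_of_mul_eq_mul_left hp.pos hxy
      · rintro k hk
        simp only [Finset.coe_filter, Finset.mem_range, Set.mem_ofPred_eq] at hk
        obtain ⟨hk, k, rfl⟩ := hk
        refine ⟨k, ?_, rfl⟩
        rw [pow_succ'] at hk
        simpa using Nat.lt_of_mul_lt_mul_left hk
    · rw [Finset.sum_congr rfl (g := fun _ ↦ h 0), Finset.sum_const, smul_eq_mul, Nat.sub_zero,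
        Nat.totient]
      · congr 2
        ext k
        simp [Nat.coprime_pow_left_iff, hp.coprime_iff_not_dvd]
      · intro k hk
        rw [← hg 0 (by omega) k, pow_zero, one_mul]
        exact ((hp.coprime_iff_not_dvd).2 (Finset.mem_filter.1 hk).2).symm

/-- Solves `∑ min μ (z i) = ν E` for `μ`, where the sum runs over the `p ^ r`-th roots of unity,
`φ(p ^ (r - i))` of which have weight `z i = E / φ(p ^ (r - i))`. -/
theorem exists_cutoff {p : ℕ} (hp : p.Prime) (hp3 : 3 ≤ p) {r ν μ E : ℕ} (hr : p ≤ r)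
    (hν : p + 1 ≤ ν) (hE : 0 < E) (z : ℕ → ℕ) (hz : ∀ i < r, (p ^ (r - i)).totient * z i = E)
    (hsum : μ + ∑ i ∈ Finset.range r, (p ^ (r - i)).totient * min μ (z i) = ν * E) :
    ∃ t, p ≤ t ∧ t ≤ r ∧ (∀ i < t, z i < μ) ∧ (∀ i < r, t ≤ i → μ < z i) ∧
      (p ^ (r - t) * μ = E ∨ t = r) := by
  have hμ : 0 < μ := by
    by_contra h
    obtain rfl : μ = 0 := by omega
    simp at hsum
    omega
  have htot (i j : ℕ) (hij : i < j) (hj : j < r) :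
      (p ^ (r - j)).totient < (p ^ (r - i)).totient :=
    strictMono_totient_prime_pow hp hp3 (by omega)
  have hmono (i j : ℕ) (hij : i ≤ j) (hj : j < r) : z i ≤ z j := by
    rcases hij.eq_or_lt with rfl | hij
    · rfl
    have h1 := hz i (by omega)
    have h2 := hz j hj
    have h3 := htot i j hij hj
    by_contra! h
    nlinarith
  have hex : ∃ t, r ≤ t ∨ μ < z t := ⟨r, Or.inl le_rfl⟩
  obtain ⟨t, htspec, htmin⟩ : ∃ t, (r ≤ t ∨ μ < z t) ∧ ∀ i < t, i < r ∧ z i ≤ μ := by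
    classical
    exact ⟨Nat.find hex, Nat.find_spec hex, fun i hi ↦ by simpa using Nat.find_min hex hi⟩
  have htr : t ≤ r := by
    by_contra! h
    exact (htmin r h).1.false
  have hge (i : ℕ) (hi : i < r) (hti : t ≤ i) : μ < z i := by
    rcases htspec with h | h
    · omega
    · exact h.trans_le (hmono t i hti hi)
  have hcalc : p ^ (r - t) * μ + t * E = ν * E := by
    rw [← hsum, ← Finset.sum_range_add_sum_Ico _ htr]
    have h1 : ∑ i ∈ Finset.range t, (p ^ (r - i)).totient * min μ (z i) = t * E := by
      rw [Finset.sum_congr rfl (g := fun _ ↦ E)]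
      · simp
      · intro i hi
        obtain ⟨h1, h2⟩ := htmin i (Finset.mem_range.1 hi)
        rw [min_eq_right h2, hz i h1]
    have h2 : ∑ i ∈ Finset.Ico t r, (p ^ (r - i)).totient * min μ (z i)
        = (∑ i ∈ Finset.Ico t r, (p ^ (r - i)).totient) * μ := by
      rw [Finset.sum_mul]
      refine Finset.sum_congr rfl fun i hi ↦ ?_
      rw [Finset.mem_Ico] at hi
      rw [min_eq_left (hge i hi.2 hi.1).le]
    have h3 : ∑ i ∈ Finset.Ico t r, (p ^ (r - i)).totient + 1 = p ^ (r - t) := by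
      have h4 := sum_totient_prime_pow hp htr
      have h5 := sum_totient_prime_pow hp (le_refl r)
      rw [← Finset.sum_range_add_sum_Ico _ htr] at h5
      simp at h5
      omega
    rw [h1, h2, ← h3]
    ring
  have htν : t < ν := by
    have : 0 < p ^ (r - t) * μ := by positivity
    by_contra! h
    nlinarith
  have hor : t + 1 = ν ∨ t = r := by
    rcases htr.eq_or_lt with h | h
    · exact Or.inr h
    left
    have h1 := hz t h
    have h2 := hge t h le_rfl
    rw [Nat.totient_prime_pow hp (by omega)] at h1
    have h3 : p ^ (r - t) = p ^ (r - t - 1) * p := by rw [← pow_succ]; congr 1; omega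
    rw [h3] at hcalc
    obtain ⟨d, rfl⟩ : ∃ d, ν = t + d := ⟨ν - t, by omega⟩
    obtain ⟨q, rfl⟩ : ∃ q, p = q + 1 := ⟨p - 1, by omega⟩
    simp only [Nat.add_sub_cancel] at h1
    set A := (q + 1) ^ (r - t - 1)
    have hA : 0 < A := by positivity
    have h4 : A * (q + 1) * μ = d * E := by linarith [add_mul t d E]
    have h5 : d * q * E < (q + 1) * E := by
      calc d * q * E = (q + 1) * (A * q * μ) := by linear_combination q * h4.symm
        _ < (q + 1) * (A * q * z t) := by
          have hq : 0 < q := by omega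
          gcongr
        _ = _ := by rw [h1]
    have h6 : d * q < q + 1 := lt_of_mul_lt_mul_right h5 hE.le
    have : d < 2 := by
      by_contra! h
      nlinarith
    omega
  have hEle : E ≤ p ^ (r - t) * μ := by
    obtain ⟨d, rfl⟩ : ∃ d, ν = t + (d + 1) := ⟨ν - t - 1, by omega⟩
    nlinarith
  refine ⟨t, by omega, htr, fun i hi ↦ ?_, hge, hor.imp_left ?_⟩
  · have hir := (htmin i hi).1
    have h1 := hz i hir
    have h2 : p ^ (r - t) < (p ^ (r - i)).totient := by
      rw [Nat.totient_prime_pow hp (by omega)]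
      calc p ^ (r - t) ≤ p ^ (r - i - 1) * 1 := by
            rw [mul_one]; exact Nat.pow_le_pow_right hp.pos (by omega)
        _ < _ := by gcongr; omega
    by_contra! h
    have : 0 < p ^ (r - t) * μ := by positivity
    nlinarith
  · rintro rfl
    linarith [add_mul t 1 E]

/-- The multiplicity of `Q` in an extended ideal is determined by that of its contraction `P`. -/
theorem emultiplicity_ideal_map {R S : Type*} [CommRing R] [IsDedekindDomain R] [CommRing S]
    [IsDedekindDomain S] (f : R →+* S) {Q : Ideal S} {P I : Ideal R} (hQ : Prime Q) (hP : Prime P)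
    (hPQ : Q.comap f = P) (hI : I ≠ ⊥) :
    emultiplicity Q (I.map f) = emultiplicity P I * emultiplicity Q (P.map f) := by
  have hfin : FiniteMultiplicity P I := FiniteMultiplicity.of_not_isUnit hP.not_isUnit hI
  obtain ⟨J, hJ, hPJ⟩ := hfin.exists_eq_pow_mul_and_not_dvd
  have h0 : emultiplicity Q (J.map f) = 0 := by
    rw [emultiplicity_eq_zero, Ideal.dvd_iff_le, Ideal.map_le_iff_le_comap, hPQ, ← Ideal.dvd_iff_le]
    exact hPJ
  conv_lhs => rw [hJ]
  rw [Ideal.map_mul, Ideal.map_pow, emultiplicity_mul hQ, emultiplicity_pow hQ, h0, add_zero,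
    hfin.emultiplicity_eq_multiplicity]

namespace Ideal

variable {R : Type*} [CommRing R]

/-- The order of vanishing of `x` along the ideal `Q`. -/
noncomputable def ordAt (Q : Ideal R) (x : R) : ℕ∞ := emultiplicity Q (span {x})

variable [IsDedekindDomain R] {Q : Ideal R}

theorem ordAt_mul (hQ : Prime Q) (x y : R) : Q.ordAt (x * y) = Q.ordAt x + Q.ordAt y := by
  rw [ordAt, ← span_singleton_mul_span_singleton, emultiplicity_mul hQ]; rfl

theorem ordAt_pow (hQ : Prime Q) (x : R) (n : ℕ) : Q.ordAt (x ^ n) = n * Q.ordAt x := by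
  rw [ordAt, ← span_singleton_pow, emultiplicity_pow hQ]; rfl

theorem ordAt_prod (hQ : Prime Q) {ι : Type*} (s : Finset ι) (f : ι → R) :
    Q.ordAt (∏ i ∈ s, f i) = ∑ i ∈ s, Q.ordAt (f i) := by
  rw [ordAt, ← prod_span_singleton, Finset.emultiplicity_prod hQ]; rfl

theorem ordAt_eq_zero {x : R} : Q.ordAt x = 0 ↔ x ∉ Q := by
  rw [ordAt, emultiplicity_eq_zero, dvd_span_singleton]

theorem ordAt_congr {x y : R} (h : Associated x y) : Q.ordAt x = Q.ordAt y := by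
  rw [ordAt, ordAt, span_singleton_eq_span_singleton.2 h]

theorem ordAt_ne_top (hQ : Prime Q) {x : R} (hx : x ≠ 0) : Q.ordAt x ≠ ⊤ :=
  finiteMultiplicity_iff_emultiplicity_ne_top.1
    (FiniteMultiplicity.of_not_isUnit hQ.not_isUnit (by simpa using hx))

theorem min_ordAt_le_ordAt_add (x y : R) : min (Q.ordAt x) (Q.ordAt y) ≤ Q.ordAt (x + y) := by
  refine ENat.forall_natCast_le_iff_le.1 fun n hn ↦ ?_
  rw [le_min_iff] at hn
  simp only [ordAt, ← pow_dvd_iff_le_emultiplicity, dvd_span_singleton] at hn ⊢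
  exact add_mem hn.1 hn.2

theorem ordAt_add_eq_min {x y : R} (h : Q.ordAt (x + y) ≤ Q.ordAt x) :
    Q.ordAt (x + y) = min (Q.ordAt x) (Q.ordAt y) := by
  refine le_antisymm (le_min h ?_) (min_ordAt_le_ordAt_add x y)
  by_contra! hlt
  have h1 := min_ordAt_le_ordAt_add (Q := Q) (x + y) (-x)
  rw [add_neg_cancel_comm, ordAt_congr (x := -x) (y := x) (by simp), min_eq_left h] at h1
  exact (hlt.trans_le h1).false

theorem totient_mul_ordAt_one_sub {p k : ℕ} (hp : p.Prime) (hQ : Prime Q) {ζ : R}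
    (hζ : IsPrimitiveRoot ζ (p ^ (k + 1))) :
    (p ^ (k + 1)).totient * Q.ordAt (1 - ζ) = Q.ordAt (p : R) := by
  have := Fact.mk hp
  have h : (p : R) = ∏ η ∈ primitiveRoots (p ^ (k + 1)) R, (1 - η) := by
    rw [← eval_one_cyclotomic_prime_pow (R := R) k, cyclotomic_eq_prod_X_sub_primitiveRoots hζ,
      eval_prod]
    simp
  rw [h, ordAt_prod hQ, Finset.sum_congr rfl (g := fun _ ↦ Q.ordAt (1 - ζ))]
  · simp [hζ.card_primitiveRoots]
  · intro η hη
    rw [mem_primitiveRoots (by have := hp.pos; positivity)] at hη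
    obtain ⟨i, -, hi, rfl⟩ := hζ.isPrimitiveRoot_iff.1 hη
    rw [← neg_sub, ← neg_sub ζ]
    exact (ordAt_congr (hζ.associated_sub_one_pow_sub_one_of_coprime hi).neg_neg).symm

/-- The orders at `Q` of the differences `m - β`, for `β` running over the `p ^ r`-th roots of `m`,
take more than `p` values; each value `W i` forces a ramification index of at least `n i`, and
`∑ n i = p ^ r`. -/
theorem exists_ordAt_root_sub (hQ : Prime Q) {p r ν E : ℕ} (hp : p.Prime) (hp3 : 3 ≤ p) (hr : p ≤ r)
    (hν : p + 1 ≤ ν) {ζ : R} (hζ : IsPrimitiveRoot ζ (p ^ r)) {a m c : R} (hp0 : (p : R) ≠ 0)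
    (hpQ : (p : R) ∈ Q) (hE : Q.ordAt (p : R) = E) (ha : a ^ p ^ r = m) (hm : m ∉ Q) (hc : c ∉ Q)
    (hmc : m ^ p ^ r - m = p ^ ν * c) :
    ∃ (k t : ℕ) (W n : Fin (t + 1) → ℕ), p ≤ t ∧ Function.Injective W ∧ (∀ i, 0 < W i) ∧
      ∑ i, n i = p ^ r ∧ (∀ i, 0 < n i) ∧ (∀ i, n i * W i = E ∨ n i = 1) ∧
      ∀ i : Fin (t + 1), Q.ordAt (m - a * ζ ^ (k + p ^ (i : ℕ))) = W i := by
  have hpr : 0 < p ^ r := by have := hp.pos; positivity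
  have hE0 : 0 < E := by
    rw [Nat.pos_iff_ne_zero]
    rintro rfl
    exact ordAt_eq_zero.1 (by simpa using hE) hpQ
  have hroot (k : ℕ) : (a * ζ ^ k) ^ p ^ r = m := by
    rw [mul_pow, ← pow_mul, mul_comm k, pow_mul, hζ.pow_eq_one, one_pow, mul_one, ha]
  have hfin (k : ℕ) : Q.ordAt (m - a * ζ ^ k) ≠ ⊤ := by
    refine ordAt_ne_top hQ fun h0 ↦ ?_
    have h1 : (p : R) ^ ν * c ≠ 0 := mul_ne_zero (pow_ne_zero _ hp0) (by rintro rfl; simp at hc)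
    rw [← hmc] at h1
    rw [sub_eq_zero] at h0
    have h2 := hroot k
    rw [← h0] at h2
    exact h1 (sub_eq_zero.2 h2)
  obtain ⟨k, -, hk⟩ := Finset.exists_max_image (Finset.range (p ^ r))
    (fun k ↦ Q.ordAt (m - a * ζ ^ k)) ⟨0, Finset.mem_range.2 hpr⟩
  have hmax (j : ℕ) : Q.ordAt (m - a * ζ ^ (k + j)) ≤ Q.ordAt (m - a * ζ ^ k) := by
    rw [pow_eq_pow_mod (k + j) hζ.pow_eq_one]
    exact hk _ (Finset.mem_range.2 (Nat.mod_lt _ hpr))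
  have haQ (j : ℕ) : a * ζ ^ j ∉ Q := by
    have : Q.IsPrime := isPrime_of_prime hQ
    intro h
    exact hm (hroot j ▸ Ideal.pow_mem_of_mem _ h _ hpr)
  have hmin (j : ℕ) : Q.ordAt (m - a * ζ ^ (k + j))
      = min (Q.ordAt (m - a * ζ ^ k)) (Q.ordAt (1 - ζ ^ j)) := by
    have h1 : m - a * ζ ^ (k + j) = (m - a * ζ ^ k) + a * ζ ^ k * (1 - ζ ^ j) := by ring
    have h2 : Q.ordAt (1 - ζ ^ j) = Q.ordAt (a * ζ ^ k * (1 - ζ ^ j)) := by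
      rw [ordAt_mul hQ (a * ζ ^ k), ordAt_eq_zero.2 (haQ k), zero_add]
    have h3 := hmax j
    rw [h1] at h3
    rw [h1, h2, ordAt_add_eq_min h3]
  lift (fun j ↦ Q.ordAt (m - a * ζ ^ (k + j))) to ℕ → ℕ using fun j ↦ hfin (k + j) with g hg
  replace hg (j : ℕ) : Q.ordAt (m - a * ζ ^ (k + j)) = g j := (congrFun hg j).symm
  have hprim (i : ℕ) (hi : i < r) : IsPrimitiveRoot (ζ ^ p ^ i) (p ^ (r - i)) :=
    hζ.pow hpr (by rw [← pow_add]; congr 1; omega)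
  set z : ℕ → ℕ := fun i ↦ (Q.ordAt (1 - ζ ^ p ^ i)).toNat
  have hz (i : ℕ) (hi : i < r) : Q.ordAt (1 - ζ ^ p ^ i) = z i := by
    refine (ENat.natCast_toNat (ordAt_ne_top hQ fun h ↦ ?_)).symm
    refine (hprim i hi).ne_one ?_ (sub_eq_zero.1 h).symm
    exact Nat.one_lt_pow (by omega) hp.one_lt
  have hzE (i : ℕ) (hi : i < r) : (p ^ (r - i)).totient * z i = E := by
    obtain ⟨s, hs⟩ : ∃ s, r - i = s + 1 := ⟨r - i - 1, by omega⟩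
    have h1 := totient_mul_ordAt_one_sub hp hQ (hs ▸ hprim i hi)
    rw [hz i hi, hE] at h1
    rw [hs]
    exact_mod_cast h1
  have hgz (i : ℕ) (hi : i < r) (u : ℕ) (hu : u.Coprime p) : g (p ^ i * u) = min (g 0) (z i) := by
    have h1 := hmin (p ^ i * u)
    rw [← add_zero k, hg 0, add_zero, hg, pow_mul] at h1
    rw [← neg_sub, ← ordAt_congr
      ((hprim i hi).associated_sub_one_pow_sub_one_of_coprime (hu.pow_right _)).neg_right,
      ← neg_sub, ordAt_congr (Associated.refl _).neg_left, hz i hi, ← Nat.mono_cast.map_min] at h1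
    exact_mod_cast h1
  have hsum : ∑ j ∈ Finset.range (p ^ r), g j = ν * E := by
    have h1 : ∏ j ∈ Finset.range (p ^ r), (m - a * ζ ^ (k + j)) = p ^ ν * c := by
      have h2 := congrArg (eval m) (X_pow_sub_C_eq_prod hζ hpr (hroot k))
      rw [← hmc]
      simp only [eval_sub, eval_pow, eval_X, eval_C, eval_prod] at h2
      rw [h2]
      refine Finset.prod_congr rfl fun j _ ↦ ?_
      ring
    have h2 := congrArg Q.ordAt h1
    rw [ordAt_prod hQ, ordAt_mul hQ, ordAt_pow hQ, ordAt_eq_zero.2 hc, hE, add_zero] at h2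
    simp only [hg] at h2
    exact_mod_cast h2
  rw [sum_range_prime_pow hp r g _ hgz] at hsum
  obtain ⟨t, hpt, htr, hlt, hge, hor⟩ := exists_cutoff hp hp3 hr hν hE0 z hzE hsum
  have hgi (i : ℕ) (hi : i < r) : g (p ^ i) = min (g 0) (z i) := by
    simpa using hgz i hi 1 (Nat.coprime_one_left p)
  have hgt : g (p ^ t) = g 0 := by
    rcases htr.eq_or_lt with rfl | h
    · have h1 : (g (p ^ t) : ℕ∞) = g 0 := by
        rw [← hg, ← hg, pow_add, hζ.pow_eq_one, mul_one, add_zero]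
      exact_mod_cast h1
    · rw [hgi t h, min_eq_left (hge t h le_rfl).le]
  have hgl (i : ℕ) (hi : i < t) : g (p ^ i) = z i := by
    rw [hgi i (by omega), min_eq_right (hlt i hi).le]
  have hzpos (i : ℕ) (hi : i < r) : 0 < z i := by
    have := hzE i hi
    exact Nat.pos_of_mul_pos_left (this ▸ hE0)
  have hzinj (i j : ℕ) (hi : i < r) (hj : j < r) (hij : z i = z j) : i = j := by
    have h1 : (p ^ (r - i)).totient = (p ^ (r - j)).totient :=
      Nat.eq_of_mul_eq_mul_right (hzpos j hj) (by rw [hzE j hj, ← hij, hzE i hi])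
    have h2 := (strictMono_totient_prime_pow hp hp3).injective h1
    omega
  refine ⟨k, t, fun i ↦ g (p ^ (i : ℕ)),
    fun i ↦ if (i : ℕ) < t then (p ^ (r - i)).totient else p ^ (r - t), hpt, ?_, ?_, ?_, ?_, ?_,
    fun i ↦ hg _⟩
  · intro i j hij
    have hij : g (p ^ (i : ℕ)) = g (p ^ (j : ℕ)) := hij
    have hWlt (i j : ℕ) (hi : i < t) (hj : j = t) : g (p ^ i) < g (p ^ j) := by
      rw [hj, hgt, hgl i hi]
      exact hlt i hi
    refine Fin.ext ?_
    rcases (Nat.lt_succ_iff.1 i.2).eq_or_lt with hi | hi <;>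
      rcases (Nat.lt_succ_iff.1 j.2).eq_or_lt with hj | hj
    · rw [hi, hj]
    · exact absurd hij (hWlt _ _ hj hi).ne'
    · exact absurd hij (hWlt _ _ hi hj).ne
    · rw [hgl _ hi, hgl _ hj] at hij
      exact hzinj _ _ (by omega) (by omega) hij
  · intro i
    rcases (Nat.lt_succ_iff.1 i.2).eq_or_lt with h | h
    · simp only [h, hgt]
      exact (hzpos 0 (by omega)).trans (hlt 0 (by have := hp.pos; omega))
    · simp only [hgl i h]
      exact hzpos i (by omega)
  · rw [Fin.sum_univ_castSucc, ← sum_totient_prime_pow hp htr, ← Fin.sum_univ_eq_sum_range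
      (fun i ↦ (p ^ (r - i)).totient)]
    simp
  · intro i
    have := hp.pos
    dsimp only
    split_ifs
    · exact Nat.totient_pos.2 (by positivity)
    · positivity
  · intro i
    dsimp only
    split_ifs with h
    · left
      rw [hgl i h, hzE i (by omega)]
    · have : (i : ℕ) = t := by omega
      rw [this, hgt]
      exact hor.imp_right (by rintro rfl; simp)

end Ideal

theorem ordAt_mul_ramificationIdx {R S : Type*} [CommRing R] [IsDedekindDomain R]
    [Module.Free ℤ R] [Module.Finite ℤ R] [CommRing S] [IsDedekindDomain S] (f : R →+* S)
    {p : ℕ} {Q : Ideal S} {P : Ideal R} [P.IsPrime] (hQ : Prime Q) (hPQ : Q.comap f = P)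
    [P.LiesOver (Ideal.span {(p : ℤ)})] (hp : (p : R) ≠ 0) {γ : R} (hγ : γ ≠ 0) {W E : ℕ}
    (hW : Q.ordAt (f γ) = W) (hE : Q.ordAt (p : S) = E) :
    W * P.ramificationIdx ℤ = E * (P.ordAt γ).toNat := by
  have hmap : (Ideal.span {(p : ℤ)}).map (algebraMap ℤ R) = Ideal.span {(p : R)} := by
    simp [Ideal.map_span]
  have hp' : Ideal.span {(p : R)} ≠ ⊥ := by simpa using hp
  have hpP : (p : R) ∈ P := by
    have h1 : (p : ℤ) ∈ P.under ℤ := by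
      rw [← Ideal.over_def P (Ideal.span {(p : ℤ)})]
      exact Ideal.mem_span_singleton_self _
    simpa [Ideal.mem_comap] using h1
  have hP : Prime P := Ideal.prime_of_isPrime (by rintro rfl; exact hp hpP) ‹_›
  have hram : P.ordAt (p : R) = P.ramificationIdx ℤ := by
    rw [Ideal.IsDedekindDomain.ramificationIdx_eq_multiplicity (Ideal.span {(p : ℤ)}) P
      (by rwa [hmap]), hmap, Ideal.ordAt, FiniteMultiplicity.emultiplicity_eq_multiplicity]
    exact FiniteMultiplicity.of_not_isUnit hP.not_isUnit hp'
  have key {x : R} (hx : x ≠ 0) :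
      Q.ordAt (f x) = P.ordAt x * emultiplicity Q (P.map f) := by
    have h1 := emultiplicity_ideal_map f hQ hP hPQ (I := Ideal.span {x}) (by simpa using hx)
    rwa [Ideal.map_span, Set.image_singleton] at h1
  have h1 := key hγ
  have h2 := key hp
  have hA := Ideal.ordAt_ne_top hP hγ
  have he := P.ramificationIdx_pos ℤ
  rw [map_natCast, hE, hram] at h2
  rw [hW, ← ENat.natCast_toNat hA] at h1
  generalize emultiplicity Q (P.map f) = e' at h1 h2
  induction e' using ENat.recTopCoe with
  | top => rw [ENat.mul_top (by exact_mod_cast he.ne')] at h2; simp at h2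
  | coe e' =>
    norm_cast at h1 h2
    rw [h1, h2]
    ring

theorem exists_algHom_of_pow_eq {K L : Type*} [Field K] [NumberField K] [Field L] [Algebra ℚ L]
    {n : ℕ} (hn : 0 < n) {m : ℤ} (hF : Irreducible ((X : ℚ[X]) ^ n - C (m : ℚ))) {α : K}
    (hgen : IntermediateField.adjoin ℚ {α} = ⊤) (hroot : α ^ n = (m : K)) :
    Module.finrank ℚ K = n ∧ ∀ β : L, β ^ n = (m : L) → ∃ σ : K →ₐ[ℚ] L, σ α = β := by
  have hα : IsIntegral ℚ α := Algebra.IsIntegral.isIntegral α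
  have hmin : (X : ℚ[X]) ^ n - C (m : ℚ) = minpoly ℚ α :=
    minpoly.eq_of_irreducible_of_monic hF (by simp [hroot]) (monic_X_pow_sub_C _ hn.ne')
  have htop : Algebra.adjoin ℚ {α} = ⊤ := by
    rw [← IntermediateField.adjoin_simple_toSubalgebra_of_isAlgebraic hα.isAlgebraic, hgen,
      IntermediateField.top_toSubalgebra]
  let pb := PowerBasis.ofAdjoinEqTop hα htop
  have hpb : pb.gen = α := PowerBasis.ofAdjoinEqTop_gen hα htop
  refine ⟨?_, fun β hβ ↦ ?_⟩
  · rw [pb.finrank, PowerBasis.ofAdjoinEqTop_dim, ← hmin, natDegree_X_pow_sub_C]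
  · have h := pb.lift_gen β (by rw [hpb, ← hmin]; simp [hβ])
    exact ⟨_, (congrArg _ hpb.symm).trans h⟩

theorem pow_prime_pow_sub_self {p r : ℕ} (hp : p.Prime) {m : ℤ}
    (hmod : m ^ (p - 1) ≡ 1 [ZMOD (p : ℤ) ^ (p + 1)]) (hne : m ^ p ^ r - m ≠ 0) :
    ¬ (p : ℤ) ∣ m ∧ ∃ ν c, p + 1 ≤ ν ∧ m ^ p ^ r - m = (p : ℤ) ^ ν * c ∧ ¬ (p : ℤ) ∣ c := by
  have hpZ : Prime (p : ℤ) := Nat.prime_iff_prime_int.1 hp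
  constructor
  · intro h
    have h1 := hmod.symm.dvd
    have h2 : (p : ℤ) ∣ m ^ (p - 1) := dvd_pow h (by have := hp.two_le; omega)
    have h3 : (p : ℤ) ∣ m ^ (p - 1) - 1 := (dvd_pow_self _ (by omega)).trans h1
    exact hpZ.not_dvd_one (by simpa using (dvd_sub h2 h3))
  have hdvd : (p : ℤ) ^ (p + 1) ∣ m ^ p ^ r - m := by
    obtain ⟨s, hs⟩ : p - 1 ∣ p ^ r - 1 := by simpa using Nat.sub_dvd_pow_sub_pow p 1 r
    have h1 : p ^ r = (p - 1) * s + 1 := by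
      have := Nat.one_le_pow r p hp.pos
      omega
    have h2 := ((hmod.pow s).mul_right m).symm.dvd
    rw [h1, pow_succ m, pow_mul]
    simpa using h2
  have hfin : FiniteMultiplicity (p : ℤ) (m ^ p ^ r - m) :=
    FiniteMultiplicity.of_not_isUnit hpZ.not_isUnit hne
  obtain ⟨c, hc, hpc⟩ := hfin.exists_eq_pow_mul_and_not_dvd
  exact ⟨_, c, hfin.le_multiplicity_of_pow_dvd hdvd, hc, hpc⟩

/-- Let `p` be an odd prime, `r ≥ p`, and `m ≠ 1` a squarefree integer with
`m^(p-1) ≡ 1 (mod p^(p+1))`, such that `x^(p^r) - m` is irreducible over `ℚ`.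
Then `K = ℚ(α)` is not monogenic, where `α` is a root. -/
theorem pure_field_not_monogenic_of_modEq
    (p r : ℕ) (hp : p.Prime) (hodd : Odd p) (hrp : p ≤ r)
    (m : ℤ) (hm : Squarefree m) (hm1 : m ≠ 1)
    (hmod : m ^ (p - 1) ≡ 1 [ZMOD (p : ℤ) ^ (p + 1)])
    (hF : Irreducible ((X : ℚ[X]) ^ p ^ r - C (m : ℚ)))
    (K : Type*) [Field K] [NumberField K] (α : K)
    (hgen : IntermediateField.adjoin ℚ {α} = ⊤)
    (hroot : α ^ p ^ r = (m : K)) :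
    ¬ ∃ θ : 𝓞 K, Algebra.adjoin ℤ {θ} = ⊤ := by
  have hp2 := hp.two_le
  have hp3 : 3 ≤ p := by
    obtain ⟨k, rfl⟩ := hodd
    omega
  have hr0 : r ≠ 0 := by omega
  have hpr : 0 < p ^ r := by positivity
  have : NeZero (p ^ r) := ⟨hpr.ne'⟩
  have hne : m ^ p ^ r - m ≠ 0 := by
    intro h0
    have h1 : ((X : ℚ[X]) ^ p ^ r - C (m : ℚ)).IsRoot (m : ℚ) := by
      simp only [IsRoot.def, eval_sub, eval_pow, eval_X, eval_C]
      exact_mod_cast h0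
    have h2 := degree_eq_one_of_irreducible_of_root hF h1
    rw [degree_X_pow_sub_C hpr] at h2
    exact (Nat.one_lt_pow hr0 hp.one_lt).ne' (by exact_mod_cast h2)
  obtain ⟨hpm, ν, c, hν, hmc, hpc⟩ := pow_prime_pow_sub_self hp hmod hne
  let L := CyclotomicField (p ^ r) K
  obtain ⟨hrank, hlift⟩ := exists_algHom_of_pow_eq (L := L) hpr hF hgen hroot
  have hζ := (IsCyclotomicExtension.zeta_spec (p ^ r) K L).toInteger_isPrimitiveRoot
  set ζ := (IsCyclotomicExtension.zeta_spec (p ^ r) K L).toInteger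
  have hpZ : Prime (p : ℤ) := Nat.prime_iff_prime_int.1 hp
  have hmax : (Ideal.span {(p : ℤ)}).IsMaximal :=
    PrincipalIdealRing.isMaximal_of_irreducible hpZ.irreducible
  obtain ⟨Q, hQmax, hQover⟩ := Ideal.exists_maximal_ideal_liesOver_of_isIntegral
    (S := 𝓞 L) (Ideal.span {(p : ℤ)})
  have hQZ (d : ℤ) : (d : 𝓞 L) ∈ Q ↔ (p : ℤ) ∣ d := by
    rw [← Ideal.mem_span_singleton, Ideal.over_def Q (Ideal.span {(p : ℤ)}), Ideal.mem_comap,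
      eq_intCast]
  have hpL : (p : 𝓞 L) ≠ 0 := by exact_mod_cast hp.ne_zero
  have hpK : (p : 𝓞 K) ≠ 0 := by exact_mod_cast hp.ne_zero
  have hpQ : (p : 𝓞 L) ∈ Q := by simpa using (hQZ p).2 dvd_rfl
  have hQ : Prime Q := Ideal.prime_of_isPrime (by rintro rfl; exact hpL hpQ) hQmax.isPrime
  obtain ⟨E, hE⟩ := ENat.ne_top_iff_exists.1 (Ideal.ordAt_ne_top hQ hpL)
  have hαint : IsIntegral ℤ α :=
    IsIntegral.of_pow hpr (by rw [hroot]; exact isIntegral_algebraMap (R := ℤ) (x := m))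
  let a : 𝓞 K := ⟨α, hαint⟩
  have ha : a ^ p ^ r = (m : 𝓞 K) := RingOfIntegers.ext ((map_pow (algebraMap (𝓞 K) K) a _).trans
    (hroot.trans (map_intCast (algebraMap (𝓞 K) K) m).symm))
  obtain ⟨k, t, W, n, hpt, hWinj, hWpos, hnsum, hnpos, hnW, hordW⟩ :=
    Ideal.exists_ordAt_root_sub hQ hp hp3 hrp hν hζ (a := algebraMap (𝓞 K) (𝓞 L) a)
      (m := (m : 𝓞 L)) (c := (c : 𝓞 L)) hpL hpQ hE.symm (by rw [← map_pow, ha, map_intCast])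
      (by rwa [hQZ]) (by rwa [hQZ]) (by exact_mod_cast congrArg (Int.cast : ℤ → 𝓞 L) hmc)
  have hσ (i : ℕ) : ∃ f : 𝓞 K →+* 𝓞 L, f a = algebraMap (𝓞 K) (𝓞 L) a * ζ ^ i := by
    have h1 : (algebraMap (𝓞 K) (𝓞 L) a * ζ ^ i) ^ p ^ r = (m : 𝓞 L) := by
      rw [mul_pow, ← map_pow, ha, map_intCast, ← pow_mul, mul_comm i, pow_mul, hζ.pow_eq_one,
        one_pow, mul_one]
    obtain ⟨σ, hσ⟩ := hlift ((algebraMap (𝓞 K) (𝓞 L) a * ζ ^ i : 𝓞 L) : L)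
      (((map_pow (algebraMap (𝓞 L) L) _ _).symm.trans (congrArg _ h1)).trans (map_intCast _ m))
    exact ⟨RingOfIntegers.mapRingHom σ, RingOfIntegers.ext hσ⟩
  choose f hf using hσ
  let P (i : Fin (t + 1)) : Ideal (𝓞 K) := Q.comap (f (k + p ^ (i : ℕ)))
  have hPprime (i) : (P i).IsPrime := Ideal.comap_isPrime _ _
  have hPover (i) : (P i).LiesOver (Ideal.span {(p : ℤ)}) := ⟨by
    rw [Ideal.over_def Q (Ideal.span {(p : ℤ)})]
    ext d
    simp [P, Ideal.mem_comap]⟩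
  have hγ0 : (m : 𝓞 K) - a ≠ 0 := by
    intro h0
    have h1 : ((m ^ p ^ r - m : ℤ) : 𝓞 K) = 0 := by
      push_cast
      rw [sub_eq_zero.1 h0, ha, sub_eq_zero.1 h0, sub_self]
    exact hne (by exact_mod_cast h1)
  have hrel (i) : W i * (P i).ramificationIdx ℤ = E * ((P i).ordAt ((m : 𝓞 K) - a)).toNat :=
    ordAt_mul_ramificationIdx (f (k + p ^ (i : ℕ))) hQ rfl hpK hγ0
      (by rw [map_sub, map_intCast, hf, hordW]) hE.symm
  have hPinj : Function.Injective P := fun i j hij ↦ by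
    refine hWinj (Nat.eq_of_mul_eq_mul_right ((P i).ramificationIdx_pos ℤ) ?_)
    rw [hrel i, hij, hrel j]
  have hram (i) : n i ≤ (P i).ramificationIdx ℤ := by
    have hpos := (P i).ramificationIdx_pos ℤ
    rcases hnW i with h | h
    · have h1 := hrel i
      rw [← h, mul_comm (n i), mul_assoc] at h1
      have h2 := Nat.eq_of_mul_eq_mul_left (hWpos i) h1
      exact Nat.le_of_dvd hpos ⟨_, h2⟩
    · omega
  have hdeg (i) : (P i).inertiaDeg ℤ = 1 :=
    have : (Ideal.span {(p : ℤ)}).IsPrime := hmax.isPrime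
    have : Finite ((Ideal.span {(p : ℤ)}).primesOver (𝓞 K)) :=
      (Algebra.QuasiFinite.finite_primesOver _)
    inertiaDeg_eq_one_of_finrank_le_sum (Ideal.span {(p : ℤ)})
      (fun i ↦ ⟨P i, hPprime i, hPover i⟩) (fun i j hij ↦ hPinj (congrArg Subtype.val hij)) n hnpos
      hram (by rw [RingOfIntegers.rank, hrank, hnsum]) i
  rintro ⟨θ, hθ⟩
  refine adjoin_singleton_ne_top_of_primes hp.pos P hPinj (by simpa using by omega)
    (fun i ↦ (Ideal.over_def (P i) (Ideal.span {(p : ℤ)})).symm) (fun i x ↦ ?_) θ hθ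
  have : (P i).IsMaximal := Ideal.IsMaximal.of_liesOver_isMaximal (P i) (Ideal.span {(p : ℤ)})
  exact exists_int_sub_mem_of_inertiaDeg_eq_one (Ideal.span {(p : ℤ)}) (P i) (hdeg i) x
end

section
/- Let m ≠ 1 be a squarefree rational integer not divisible by 3 with ν_3(m^2 − 1) ≥ 4, such that F(x) = x^27 − m is irreducible over ℚ. Let α be a complex root of F and K = ℚ(α). Then K is not monogenic. -/
open Polynomial NumberField

theorem exists_three_mul_eq_of_mul_cube_sub_one {R : Type*} [CommRing R] [IsDomain R] [CharZero R]
    [IsIntegrallyClosed R] {y w j : R} (hj : j ≠ 0) (h : w * (y ^ 3 - 1) = 9 * j) :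
    ∃ x, 3 * x = w * (y ^ 2 + y + 1) ∧ x * (y - 1) = 3 * j := by
  have h3 : (3 : R) ≠ 0 := by norm_num
  let L := FractionRing R
  obtain ⟨f, hfL⟩ : ∃ f : R →+* L, f = algebraMap R L := ⟨_, rfl⟩
  have hf : Function.Injective f := hfL ▸ IsFractionRing.injective R L
  have h3' : (3 : L) ≠ 0 := by
    rw [← map_ofNat f 3]
    exact (map_ne_zero_iff f hf).2 h3
  have hj' : f j ≠ 0 := (map_ne_zero_iff f hf).2 hj
  have h' : f w * (f y ^ 3 - 1) = 9 * f j := by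
    simpa [map_ofNat f] using congrArg f h
  set z : L := f w * (f y ^ 2 + f y + 1) / 3 with hz
  have hz3 : 3 * z = f w * (f y ^ 2 + f y + 1) := mul_div_cancel₀ _ h3'
  have hzc : z * (f y - 1) = 3 * f j := by
    apply mul_left_cancel₀ h3'
    linear_combination (f y - 1) * hz3 + h'
  have hc : f y - 1 ≠ 0 := by
    intro h0
    rw [h0, mul_zero] at hzc
    exact mul_ne_zero h3' hj' hzc.symm
  have hroot : z ^ 3 - f w * z ^ 2 - 3 * f j * f w * z - 3 * f j ^ 2 * f w = 0 := by
    have e : (f y - 1) ^ 2 * (z ^ 3 - f w * z ^ 2 - 3 * f j * f w * z - 3 * f j ^ 2 * f w) = 0 := by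
      generalize f y = Y at *
      generalize f w = W at *
      generalize f j = J at *
      have e1 : z ^ 2 * (Y - 1) ^ 2 = 9 * J ^ 2 := by rw [← mul_pow, hzc]; ring
      linear_combination (z - W) * e1 + 3 * J ^ 2 * hz3 - 3 * J * W * (Y - 1) * hzc
    exact (mul_eq_zero.1 e).resolve_left (pow_ne_zero 2 hc)
  have hint : IsIntegral R z := by
    refine ⟨X ^ 3 - C w * X ^ 2 - C (3 * j * w) * X - C (3 * j ^ 2 * w), by monicity!, ?_⟩
    rw [← hroot]
    simp [← hfL, L, map_ofNat f, eval₂_pow]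
  obtain ⟨x, hx⟩ := IsIntegrallyClosed.isIntegral_iff.1 hint
  rw [← hfL] at hx
  refine ⟨x, hf ?_, hf ?_⟩
  · simpa [hx, map_ofNat f] using hz3
  · simpa [hx, map_ofNat f] using hzc

theorem mem_of_three_mul_eq_twist {S : Type*} [CommRing S] [IsDomain S] [CharZero S] {M : Ideal S}
    [hM : M.IsPrime] (h3 : (3 : S) ∈ M) {y ω w x x' j : S} (hω : ω ^ 2 + ω + 1 = 0)
    (hxj : x * (y - 1) = 3 * j) (hx' : 3 * x' = w * ((y * ω) ^ 2 + y * ω + 1))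
    (hy : y - 1 ∈ M) (hxM : x ∉ M) : x' ∈ M := by
  have h30 : (3 : S) ≠ 0 := by norm_num
  have hω1 : ω - 1 ∈ M := by
    refine hM.mem_of_pow_mem 2 ?_
    rw [show (ω - 1) ^ 2 = -ω * 3 by linear_combination hω]
    exact M.mul_mem_left _ h3
  have key : x * x' = w * j * ω ^ 2 * (y - 1) + w * j * ω * 2 * (ω - 1) + w * j * ω * 3 := by
    apply mul_left_cancel₀ h30
    linear_combination x * hx' + w * (ω ^ 2 * (y + 1) + ω) * hxj + w * x * hω
  refine (hM.mem_or_mem (?_ : x * x' ∈ M)).resolve_left hxM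
  rw [key]
  exact M.add_mem (M.add_mem (M.mul_mem_left _ hy) (M.mul_mem_left _ hω1)) (M.mul_mem_left _ h3)

theorem mem_of_three_mul_eq_of_mem {R : Type*} [CommRing R] [IsDomain R] [CharZero R] {P : Ideal R}
    [hP : P.IsPrime] {y w x j : R} (hx : 3 * x = w * (y ^ 2 + y + 1))
    (hxj : x * (y - 1) = 3 * j) (hw : w ∈ P) : x ∈ P := by
  have h30 : (3 : R) ≠ 0 := by norm_num
  refine hP.mem_of_pow_mem 2 ?_
  have : x ^ 2 = (x + 3 * j + j * (y - 1)) * w := by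
    apply mul_left_cancel₀ h30
    linear_combination x * hx + w * (y + 2) * hxj
  rw [this]
  exact P.mul_mem_left _ hw

theorem sub_one_mem_of_cube_sub_one_mem {R : Type*} [CommRing R] {P : Ideal R}
    [hP : P.IsPrime] (h3 : (3 : R) ∈ P) {y : R} (hy : y ^ 3 - 1 ∈ P) : y - 1 ∈ P := by
  refine hP.mem_of_pow_mem 3 ?_
  rw [show (y - 1) ^ 3 = (y ^ 3 - 1) - y * (y - 1) * 3 by ring]
  exact P.sub_mem hy (P.mul_mem_left _ h3)

theorem exists_isPrime_three_mem : ∃ M : Ideal (𝓞 ℂ), M.IsPrime ∧ (3 : 𝓞 ℂ) ∈ M := by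
  have : (Ideal.span {(3 : ℤ)}).IsMaximal :=
    PrincipalIdealRing.isMaximal_of_irreducible Int.prime_three.irreducible
  obtain ⟨M, hM, hc⟩ := Ideal.exists_ideal_over_maximal_of_isIntegral (S := 𝓞 ℂ)
    (Ideal.span {(3 : ℤ)}) (by
      rw [(RingHom.injective_iff_ker_eq_bot _).1 (FaithfulSMul.algebraMap_injective ℤ (𝓞 ℂ))]
      exact bot_le)
  refine ⟨M, hM.isPrime, ?_⟩
  have : (3 : ℤ) ∈ M.comap (algebraMap ℤ (𝓞 ℂ)) := hc ▸ Ideal.mem_span_singleton_self _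
  simpa using this

theorem not_adjoin_eq_top_of_four_primes {K : Type*} [Field K] [NumberField K]
    (hK : Module.finrank ℚ K = 27) (P : Fin 4 → Ideal (𝓞 K)) (hP : ∀ i, (P i).IsPrime)
    (hinj : Function.Injective P) (h3 : ∀ i, (3 : 𝓞 K) ∈ P i ^ (![1, 2, 6, 18] i)) :
    ¬ ∃ θ : 𝓞 K, Algebra.adjoin ℤ {θ} = ⊤ := by
  have hmem : ∀ i, (3 : 𝓞 K) ∈ P i := fun i ↦
    Ideal.pow_le_self (by fin_cases i <;> simp) (h3 i)
  have hbot : ∀ i, P i ≠ ⊥ := fun i h ↦ by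
    have := hmem i
    rw [h, Ideal.mem_bot] at this
    norm_num at this
  have hmax : ∀ i, (P i).IsMaximal := fun i ↦ (hP i).isMaximal (hbot i)
  have hN3 : Ideal.absNorm (Ideal.span {(3 : 𝓞 K)}) = 3 ^ 27 := by
    rw [Ideal.absNorm_span_singleton]
    have : Algebra.norm ℤ (algebraMap ℤ (𝓞 K) 3) = 3 ^ 27 := by
      rw [Algebra.norm_algebraMap, RingOfIntegers.rank, hK]
    rw [show (3 : 𝓞 K) = algebraMap ℤ (𝓞 K) 3 by simp, this]
    rfl
  have hprod : ∏ i, P i ^ (![1, 2, 6, 18] i) ∣ Ideal.span {(3 : 𝓞 K)} := by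
    refine Finset.prod_dvd_of_coprime (fun i _ j _ hij ↦ ?_) fun i _ ↦ ?_
    · exact (Ideal.isCoprime_of_isMaximal (hinj.ne hij)).pow
    · rw [Ideal.dvd_span_singleton]; exact h3 i
  have hNi : ∀ i, ∃ f, 1 ≤ f ∧ Ideal.absNorm (P i) = 3 ^ f := fun i ↦ by
    have hd : Ideal.absNorm (P i) ∣ 3 ^ 27 := by
      rw [← hN3]
      exact Ideal.absNorm_dvd_absNorm_of_le (by simpa using hmem i)
    obtain ⟨f, -, hf⟩ := (Nat.dvd_prime_pow Nat.prime_three).1 hd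
    refine ⟨f, Nat.one_le_iff_ne_zero.2 fun h0 ↦ ?_, hf⟩
    rw [h0, pow_zero, Ideal.absNorm_eq_one_iff] at hf
    exact (hP i).ne_top hf
  choose f hf1 hf using hNi
  have hle : f 0 + f 1 * 2 + f 2 * 6 + f 3 * 18 ≤ 27 := by
    have := map_dvd Ideal.absNorm hprod
    rw [hN3, map_prod] at this
    simp only [map_pow, hf, Fin.prod_univ_four, ← pow_mul, ← pow_add] at this
    simpa using (Nat.pow_dvd_pow_iff_le_right (by norm_num)).1 this
  have hcard : ∀ i, Ideal.absNorm (P i) = 3 := fun i ↦ by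
    have h0 := hf1 0
    have h1 := hf1 1
    have h2 := hf1 2
    have h3 := hf1 3
    have : f i = 1 := by fin_cases i <;> simp <;> omega
    rw [hf, this, pow_one]
  have hex : ∀ i, ∃ φ : 𝓞 K →+* ZMod 3, RingHom.ker φ = P i := fun i ↦ by
    have hc : Nat.card (𝓞 K ⧸ P i) = 3 := hcard i
    have : Finite (𝓞 K ⧸ P i) := Nat.finite_of_card_ne_zero (by simp [hc])
    let := Fintype.ofFinite (𝓞 K ⧸ P i)
    rw [Nat.card_eq_fintype_card] at hc
    let e := ZMod.ringEquivOfPrime (𝓞 K ⧸ P i) Nat.prime_three hc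
    refine ⟨(e.symm : (𝓞 K ⧸ P i) →+* ZMod 3).comp (Ideal.Quotient.mk (P i)), ?_⟩
    exact (RingHom.ker_equiv_comp _ e.symm).trans Ideal.mk_ker
  choose φ hφ using hex
  rintro ⟨θ, hθ⟩
  obtain ⟨i, j, hij, h⟩ := Fintype.exists_ne_map_eq_of_card_lt (fun i ↦ φ i θ) (by simp)
  refine hij (hinj ?_)
  have : (φ i).toIntAlgHom = (φ j).toIntAlgHom :=
    AlgHom.ext_of_adjoin_eq_top hθ (by simpa using h)
  have hφij : φ i = φ j := RingHom.ext fun x ↦ DFunLike.congr_fun this x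
  rw [← hφ i, ← hφ j, hφij]

theorem three_mem_pow_of_mul_pow_eq {R : Type*} [CommRing R] [IsDedekindDomain R] {P : Ideal R}
    [P.IsPrime] {c w s : R} {n : ℕ} (hc : c ∈ P) (hs : s ∉ P) (h : w * c ^ n = s * 3) :
    (3 : R) ∈ P ^ n :=
  (Ideal.IsPrime.mul_mem_pow P
    (h ▸ (P ^ n).mul_mem_left w (Ideal.pow_mem_pow hc n))).resolve_left hs

theorem three_mem_sq {R : Type*} [CommRing R] [IsDedekindDomain R] {P : Ideal R}
    [hP : P.IsPrime] {y w x : R} (hy : y - 1 ∈ P) (hx : 3 * x = w * (y ^ 2 + y + 1))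
    (hxP : x ∈ P) (hwP : w ∉ P) : (3 : R) ∈ P ^ 2 := by
  refine three_mem_pow_of_mul_pow_eq (w := w) (s := x - y * w) hy (fun hs ↦ hwP ?_)
    (by linear_combination -hx)
  rw [show w = x - (x - y * w) - w * (y - 1) by ring]
  exact P.sub_mem (P.sub_mem hxP hs) (P.mul_mem_left _ hy)

theorem three_mem_pow_six {R : Type*} [CommRing R] [IsDedekindDomain R] {P : Ideal R}
    [hP : P.IsPrime] {y w x : R} (hy : y - 1 ∈ P)
    (hx : 3 * x = w * ((y ^ 3) ^ 2 + y ^ 3 + 1)) (hxP : x ∈ P) (hwP : w ∉ P) :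
    (3 : R) ∈ P ^ 6 := by
  refine three_mem_pow_of_mul_pow_eq (w := w)
    (s := x - y ^ 3 * w + w * y * (y - 1) * (3 * y * (y - 1) - 2 * (y ^ 3 - 1)))
    hy (fun hs ↦ hwP ?_) (by linear_combination -hx)
  rw [← Ideal.Quotient.eq_zero_iff_mem] at *
  simp only [map_add, map_sub, map_mul, map_pow, map_one, sub_eq_zero] at hs hy hxP ⊢
  simp only [hy, hxP] at hs
  linear_combination -hs

theorem three_mem_pow_eighteen {R : Type*} [CommRing R] [IsDedekindDomain R] {P : Ideal R}
    [hP : P.IsPrime] (h3 : (3 : R) ∈ P) {y x : R} (hy : y - 1 ∈ P)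
    (hx : 3 * x = (y ^ 9) ^ 2 + y ^ 9 + 1) (hxP : x ∈ P) : (3 : R) ∈ P ^ 18 := by
  obtain ⟨u, hu⟩ : ∃ u, u = -y ^ 3 * (y ^ 3 - 1) - 3 * (y ^ 3 - 1) ^ 2 * y * (y - 1)
    + 9 * (y ^ 3 - 1) * y ^ 2 * (y - 1) ^ 2 - 9 * y ^ 3 * (y - 1) ^ 3 := ⟨_, rfl⟩
  have h9 : (y - 1) ^ 9 = y ^ 9 - 1 + 3 * u := by rw [hu]; ring
  refine three_mem_pow_of_mul_pow_eq (w := 1)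
    (s := x - y ^ 9 + 2 * (y ^ 9 - 1) * u + 3 * u ^ 2)
    hy (fun hs ↦ hP.ne_top ((Ideal.eq_top_iff_one _).2 ?_))
    (by linear_combination -hx + ((y - 1) ^ 9 + (y ^ 9 - 1 + 3 * u)) * h9)
  rw [← Ideal.Quotient.eq_zero_iff_mem] at *
  simp only [map_add, map_sub, map_mul, map_pow, map_one, sub_eq_zero] at hs hy hxP ⊢
  simp only [hy, hxP, h3] at hs
  linear_combination -hs

theorem exists_ringHom_apply_eq {K : Type*} [Field K] [NumberField K] {m : ℤ} {α : 𝓞 K}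
    (hK : Module.finrank ℚ K = 27) (hgen : IntermediateField.adjoin ℚ {(α : K)} = ⊤)
    (hroot : α ^ 27 = m) {ρ : 𝓞 ℂ} (hρ : ρ ^ 27 = m) : ∃ ψ : 𝓞 K →+* 𝓞 ℂ, ψ α = ρ := by
  have hmin : X ^ 27 - C (m : ℚ) = minpoly ℚ (α : K) := by
    refine minpoly.unique_of_degree_le_degree_minpoly _ _ (by monicity!) ?_ ?_
    · have := congrArg (algebraMap (𝓞 K) K) hroot
      simp only [map_pow, map_intCast] at this
      simp [this]
    · rw [degree_X_pow_sub_C (by norm_num), degree_eq_natDegree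
        (minpoly.ne_zero (Algebra.IsIntegral.isIntegral _)),
        (Field.primitive_element_iff_minpoly_natDegree_eq ℚ _).1 hgen, hK]
  obtain ⟨f, hf⟩ := IntermediateField.exists_algHom_of_adjoin_splits_of_aeval (F := ℚ) (K := ℂ)
    (S := {(α : K)}) (x := (α : K)) (y := (ρ : ℂ))
    (fun s _ ↦ ⟨Algebra.IsIntegral.isIntegral s, IsAlgClosed.splits _⟩) hgen (by
      have := congrArg (algebraMap (𝓞 ℂ) ℂ) hρ
      simp only [map_pow, map_intCast] at this
      simp [← hmin, this])
  exact ⟨RingOfIntegers.mapRingHom f, RingOfIntegers.ext hf⟩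

theorem IsPrimitiveRoot.sum_sum_mul_pow_pow {S : Type*} [CommRing S] [IsDomain S] {ζ : S} {n : ℕ}
    (hζ : IsPrimitiveRoot ζ n) (r : S) :
    ∑ i ∈ Finset.range n, ∑ j ∈ Finset.range n, (r * ζ ^ i) ^ j = n := by
  rw [Finset.sum_comm]
  rcases Nat.eq_zero_or_pos n with rfl | hn
  · simp
  rw [Finset.sum_eq_single_of_mem 0 (by simpa) fun j hj hj0 ↦ ?_]
  · simp
  have h1 : ζ ^ j ≠ 1 := hζ.pow_ne_one_of_pos_of_lt hj0 (Finset.mem_range.1 hj)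
  have h2 : ∑ i ∈ Finset.range n, (ζ ^ j) ^ i = 0 := by
    refine (mul_eq_zero.1 ?_).resolve_left (sub_ne_zero.2 h1)
    rw [mul_geom_sum, ← pow_mul, mul_comm, pow_mul, hζ.pow_eq_one, one_pow, sub_self]
  have h3 : ∀ i, (r * ζ ^ i) ^ j = r ^ j * (ζ ^ j) ^ i := fun i ↦ by ring
  simp_rw [h3, ← Finset.mul_sum, h2, mul_zero]

theorem exists_isPrimitiveRoot_ringOfIntegers_complex {n : ℕ} (hn : n ≠ 0) :
    ∃ ζ : 𝓞 ℂ, IsPrimitiveRoot ζ n := by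
  have h := Complex.isPrimitiveRoot_exp n hn
  refine ⟨⟨_, h.isIntegral (Nat.pos_of_ne_zero hn)⟩, ?_⟩
  exact IsPrimitiveRoot.of_map_of_injective (f := algebraMap (𝓞 ℂ) ℂ) h
    RingOfIntegers.coe_injective

theorem exists_pow_eq_intCast_ringOfIntegers_complex {n : ℕ} (hn : 0 < n) (m : ℤ) :
    ∃ r : 𝓞 ℂ, r ^ n = m := by
  obtain ⟨r, hr⟩ := IsAlgClosed.exists_pow_nat_eq (m : ℂ) hn
  have hint : IsIntegral ℤ r := IsIntegral.of_pow hn (hr ▸ isIntegral_algebraMap (R := ℤ) (x := m))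
  exact ⟨⟨r, hint⟩, RingOfIntegers.ext ((map_pow (algebraMap (𝓞 ℂ) ℂ) _ n).trans
    (hr.trans (map_intCast (algebraMap (𝓞 ℂ) ℂ) m).symm))⟩

theorem not_monogenic_of_pow_eq_one_add {K : Type*} [Field K] [NumberField K] {n : ℤ} {α : 𝓞 K}
    (hn : n ≠ 0) (hK : Module.finrank ℚ K = 27)
    (hgen : IntermediateField.adjoin ℚ {(α : K)} = ⊤) (hroot : α ^ 27 = 1 + 81 * n) :
    ¬ ∃ θ : 𝓞 K, Algebra.adjoin ℤ {θ} = ⊤ := by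
  have hn' : (n : 𝓞 K) ≠ 0 := by exact_mod_cast hn
  obtain ⟨x₂, h₂, h₂'⟩ := exists_three_mul_eq_of_mul_cube_sub_one (y := α ^ 9) (w := 1)
    (j := 9 * n) (by simpa using hn') (by linear_combination hroot)
  obtain ⟨x₁, h₁, h₁'⟩ := exists_three_mul_eq_of_mul_cube_sub_one (y := α ^ 3) (w := x₂)
    (j := 3 * n) (by simpa using hn') (by linear_combination h₂')
  obtain ⟨x₀, h₀, h₀'⟩ := exists_three_mul_eq_of_mul_cube_sub_one (y := α) (w := x₁)
    (j := n) hn' (by linear_combination h₁')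
  have hsum : 27 * x₀ = ∑ j ∈ Finset.range 27, α ^ j := by
    simp only [Finset.sum_range_succ, Finset.sum_range_zero]
    linear_combination 9 * h₀ + 3 * (α ^ 2 + α + 1) * h₁
      + (α ^ 2 + α + 1) * ((α ^ 3) ^ 2 + α ^ 3 + 1) * h₂
  obtain ⟨M, hM, h3M⟩ := exists_isPrime_three_mem
  obtain ⟨ζ, hζ⟩ := exists_isPrimitiveRoot_ringOfIntegers_complex (n := 27) (by norm_num)
  obtain ⟨r, hr⟩ :=
    exists_pow_eq_intCast_ringOfIntegers_complex (n := 27) (by norm_num) (1 + 81 * n)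
  have hζ1 : ζ ^ 27 = 1 := hζ.pow_eq_one
  have hrζ : ∀ {ρ : 𝓞 ℂ} (i : ℕ), ρ ^ 27 = (1 + 81 * n : ℤ) →
      (ρ * ζ ^ i) ^ 27 = (1 + 81 * n : ℤ) := fun {ρ} i h ↦ by
    rw [mul_pow, h, ← pow_mul, mul_comm i, pow_mul, hζ1, one_pow, mul_one]
  have hω : (ζ ^ 9) ^ 2 + ζ ^ 9 + 1 = 0 := by
    refine (mul_eq_zero.1 ?_).resolve_left
      (sub_ne_zero.2 (hζ.pow_ne_one_of_pos_of_lt (l := 9) (by norm_num) (by norm_num)))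
    linear_combination hζ1
  have hψ : ∀ ρ : 𝓞 ℂ, ρ ^ 27 = (1 + 81 * n : ℤ) → ∃ ψ : 𝓞 K →+* 𝓞 ℂ, ψ α = ρ := fun ρ hρ ↦
    exists_ringHom_apply_eq hK hgen (by rw [hroot]; push_cast; rfl) hρ
  obtain ⟨ψ₀, h₀M⟩ : ∃ ψ : 𝓞 K →+* 𝓞 ℂ, ψ x₀ ∉ M := by
    by_contra! hall
    choose ψ hψα using fun i ↦ hψ _ (hrζ i hr)
    have : ∑ i ∈ Finset.range 27, ψ i x₀ = 1 := by
      have h27 : (27 : 𝓞 ℂ) ≠ 0 := by norm_num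
      apply mul_left_cancel₀ h27
      rw [Finset.mul_sum, mul_one]
      convert hζ.sum_sum_mul_pow_pow r using 2 with i
      · simpa [hψα, map_ofNat (ψ i)] using congrArg (ψ i) hsum
      · rfl
    exact hM.ne_top ((Ideal.eq_top_iff_one _).2 (this ▸ M.sum_mem fun i _ ↦ hall _))
  obtain ⟨ρ, hρ⟩ : ∃ ρ, ρ = ψ₀ α := ⟨_, rfl⟩
  have hρ27 : ρ ^ 27 = (1 + 81 * n : ℤ) := by
    simpa [← hρ, map_ofNat ψ₀] using congrArg ψ₀ hroot
  obtain ⟨ψ₁, hψ₁⟩ := hψ _ (hrζ 9 hρ27)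
  obtain ⟨ψ₂, hψ₂⟩ := hψ _ (hrζ 3 hρ27)
  obtain ⟨ψ₃, hψ₃⟩ := hψ _ (hrζ 1 hρ27)
  have e₂ (ψ : 𝓞 K →+* 𝓞 ℂ) : 3 * ψ x₂ = (ψ α ^ 9) ^ 2 + ψ α ^ 9 + 1 := by
    simpa [map_ofNat ψ] using congrArg ψ h₂
  have e₁ (ψ : 𝓞 K →+* 𝓞 ℂ) : 3 * ψ x₁ = ψ x₂ * ((ψ α ^ 3) ^ 2 + ψ α ^ 3 + 1) := by
    simpa [map_ofNat ψ] using congrArg ψ h₁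
  have e₀ (ψ : 𝓞 K →+* 𝓞 ℂ) : 3 * ψ x₀ = ψ x₁ * (ψ α ^ 2 + ψ α + 1) := by
    simpa [map_ofNat ψ] using congrArg ψ h₀
  have h30 : (3 : 𝓞 ℂ) ≠ 0 := by norm_num
  have hα1 : ∀ {P : Ideal (𝓞 K)}, P.IsPrime → 3 ∈ P → α - 1 ∈ P := fun {P} hP h3 ↦ by
    refine sub_one_mem_of_cube_sub_one_mem h3 (sub_one_mem_of_cube_sub_one_mem h3
      (sub_one_mem_of_cube_sub_one_mem h3 ?_))
    rw [show ((α ^ 3) ^ 3) ^ 3 - 1 = 27 * n * 3 by linear_combination hroot]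
    exact P.mul_mem_left _ h3
  let P (ψ : 𝓞 K →+* 𝓞 ℂ) : Ideal (𝓞 K) := M.comap ψ
  have hP (ψ) : (P ψ).IsPrime := Ideal.comap_isPrime ψ M
  have h3P (ψ) : 3 ∈ P ψ := by simpa [P, Ideal.mem_comap, map_ofNat ψ] using h3M
  have m₂₁ (ψ) : x₂ ∈ P ψ → x₁ ∈ P ψ := mem_of_three_mul_eq_of_mem h₁ h₁'
  have m₁₀ (ψ) : x₁ ∈ P ψ → x₀ ∈ P ψ := mem_of_three_mul_eq_of_mem h₀ h₀'
  have q₀₀ : x₀ ∉ P ψ₀ := h₀M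
  have q₀₁ : x₁ ∉ P ψ₀ := mt (m₁₀ ψ₀) q₀₀
  have q₀₂ : x₂ ∉ P ψ₀ := mt (m₂₁ ψ₀) q₀₁
  have t₂ : ∀ ψ : 𝓞 K →+* 𝓞 ℂ, ψ α ^ 9 = ρ ^ 9 → ψ x₂ = ψ₀ x₂ := fun ψ h ↦ by
    apply mul_left_cancel₀ h30
    rw [e₂, e₂, h, hρ]
  have t₁ : ∀ ψ : 𝓞 K →+* 𝓞 ℂ, ψ α ^ 3 = ρ ^ 3 → ψ x₁ = ψ₀ x₁ := fun ψ h ↦ by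
    apply mul_left_cancel₀ h30
    rw [e₁, e₁, t₂ ψ (by linear_combination (ψ α ^ 6 + ψ α ^ 3 * ρ ^ 3 + ρ ^ 6) * h), h, hρ]
  have c₁ : ψ₁ α ^ 3 = ρ ^ 3 := by
    rw [hψ₁]
    linear_combination ρ ^ 3 * hζ1
  have c₂ : ψ₂ α ^ 9 = ρ ^ 9 := by
    rw [hψ₂]
    linear_combination ρ ^ 9 * hζ1
  have q₁₁ : x₁ ∉ P ψ₁ := by
    simpa only [P, Ideal.mem_comap, t₁ ψ₁ c₁] using q₀₁
  have q₁₂ : x₂ ∉ P ψ₁ := mt (m₂₁ ψ₁) q₁₁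
  have q₂₂ : x₂ ∉ P ψ₂ := by
    simpa only [P, Ideal.mem_comap, t₂ ψ₂ c₂] using q₀₂
  have hρ1 : ρ - 1 ∈ M := by
    simpa [P, Ideal.mem_comap, ← hρ] using hα1 (hP ψ₀) (h3P ψ₀)
  have hρ3 : ρ ^ 3 - 1 ∈ M := M.mem_of_dvd (sub_one_dvd_pow_sub_one ρ 3) hρ1
  have hρ9 : ρ ^ 9 - 1 ∈ M := M.mem_of_dvd (sub_one_dvd_pow_sub_one ρ 9) hρ1
  have q₁₀ : x₀ ∈ P ψ₁ := mem_of_three_mul_eq_twist h3M hω (y := ρ) (x := ψ₀ x₀) (x' := ψ₁ x₀)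
    (w := ψ₀ x₁) (j := n) (by simpa [map_ofNat ψ₀, ← hρ] using congrArg ψ₀ h₀')
    (by rw [e₀, t₁ ψ₁ c₁, hψ₁]) hρ1 q₀₀
  have q₂₁ : x₁ ∈ P ψ₂ := mem_of_three_mul_eq_twist h3M hω (y := ρ ^ 3) (x := ψ₀ x₁) (x' := ψ₂ x₁)
    (w := ψ₀ x₂) (j := 3 * n) (by simpa [map_ofNat ψ₀, ← hρ] using congrArg ψ₀ h₁')
    (by rw [e₁, t₂ ψ₂ c₂, hψ₂]; ring) hρ3 q₀₁
  have q₃₂ : x₂ ∈ P ψ₃ := mem_of_three_mul_eq_twist h3M hω (y := ρ ^ 9) (x := ψ₀ x₂) (x' := ψ₃ x₂)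
    (w := 1) (j := 9 * n) (by simpa [map_ofNat ψ₀, ← hρ] using congrArg ψ₀ h₂')
    (by rw [e₂, hψ₃]; ring) hρ9 q₀₂
  have q₂₀ : x₀ ∈ P ψ₂ := m₁₀ ψ₂ q₂₁
  have q₃₁ : x₁ ∈ P ψ₃ := m₂₁ ψ₃ q₃₂
  have q₃₀ : x₀ ∈ P ψ₃ := m₁₀ ψ₃ q₃₁
  refine not_adjoin_eq_top_of_four_primes hK (fun i ↦ P (![ψ₀, ψ₁, ψ₂, ψ₃] i)) (fun i ↦ hP _)
    (fun i j hij ↦ ?_) fun i ↦ ?_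
  · have k₀ : ∀ i, x₀ ∈ P (![ψ₀, ψ₁, ψ₂, ψ₃] i) ↔ 1 ≤ i := by
      intro i; fin_cases i <;> simp [q₀₀, q₁₀, q₂₀, q₃₀]
    have k₁ : ∀ i, x₁ ∈ P (![ψ₀, ψ₁, ψ₂, ψ₃] i) ↔ 2 ≤ i := by
      intro i; fin_cases i <;> simp [q₀₁, q₁₁, q₂₁, q₃₁]
    have k₂ : ∀ i, x₂ ∈ P (![ψ₀, ψ₁, ψ₂, ψ₃] i) ↔ 3 ≤ i := by
      intro i; fin_cases i <;> simp [q₀₂, q₁₂, q₂₂, q₃₂]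
    have e : ∀ i j : Fin 4, (1 ≤ i ↔ 1 ≤ j) → (2 ≤ i ↔ 2 ≤ j) → (3 ≤ i ↔ 3 ≤ j) → i = j := by
      decide
    simp only at hij
    exact e i j (by rw [← k₀, hij, k₀]) (by rw [← k₁, hij, k₁]) (by rw [← k₂, hij, k₂])
  · have hα (ψ) : α - 1 ∈ P ψ := hα1 (hP ψ) (h3P ψ)
    fin_cases i
    · simpa using h3P ψ₀
    · exact three_mem_sq (hα ψ₁) h₀ q₁₀ q₁₁
    · exact three_mem_pow_six (hα ψ₂) h₁ q₂₁ q₂₂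
    · exact three_mem_pow_eighteen (h3P ψ₃) (hα ψ₃) (by simpa using h₂) q₃₂

/-- If `m ≠ 1` is squarefree, not divisible by `3`, with `ν_3(m^2 - 1) ≥ 4`, and
`x^27 - m` is irreducible over `ℚ`, then `K = ℚ(α)` is not monogenic, where `α`
is a root. -/
theorem pure_degree_27_field_not_monogenic
    (m : ℤ) (hm : Squarefree m) (hm1 : m ≠ 1) (h3m : ¬ (3 : ℤ) ∣ m)
    (hval : 4 ≤ padicValInt 3 (m ^ 2 - 1))
    (hF : Irreducible ((X : ℚ[X]) ^ 27 - C (m : ℚ)))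
    (K : Type*) [Field K] [NumberField K] (α : K)
    (hgen : IntermediateField.adjoin ℚ {α} = ⊤)
    (hroot : α ^ 27 = (m : K)) :
    ¬ ∃ θ : 𝓞 K, Algebra.adjoin ℤ {θ} = ⊤ := by
  have hK : Module.finrank ℚ K = 27 := by
    have hmin : X ^ 27 - C (m : ℚ) = minpoly ℚ α :=
      minpoly.eq_of_irreducible_of_monic hF (by simp [hroot]) (by monicity!)
    rw [← (Field.primitive_element_iff_minpoly_natDegree_eq ℚ α).1 hgen, ← hmin,
      natDegree_X_pow_sub_C]
  have hm1' : m ≠ -1 := by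
    rintro rfl
    simp at hval
  have hint : IsIntegral ℤ α :=
    IsIntegral.of_pow (n := 27) (by norm_num) (hroot ▸ isIntegral_algebraMap (R := ℤ) (x := m))
  obtain ⟨a, rfl⟩ : ∃ a : 𝓞 K, (a : K) = α := ⟨⟨α, hint⟩, rfl⟩
  have ha : a ^ 27 = m := RingOfIntegers.ext (by simpa using hroot)
  have hdvd : (3 : ℤ) ^ 4 ∣ (m - 1) * (m + 1) := by
    rw [show (m - 1) * (m + 1) = m ^ 2 - 1 by ring]
    exact_mod_cast (pow_dvd_pow _ hval).trans (padicValInt_dvd (p := 3) (m ^ 2 - 1))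
  have hcase : (3 : ℤ) ∣ m - 1 ∨ (3 : ℤ) ∣ m + 1 := by lia
  have hcop : ∀ {x : ℤ}, ¬ 3 ∣ x → IsCoprime ((3 : ℤ) ^ 4) x := fun h ↦
    ((Int.prime_three.coprime_iff_not_dvd).2 h).pow_left
  rcases hcase with h | h
  · obtain ⟨n, hn⟩ := (hcop (by lia)).dvd_of_dvd_mul_right hdvd
    refine not_monogenic_of_pow_eq_one_add (n := n) (by lia) hK hgen ?_
    rw [ha, show m = 1 + 81 * n by lia]
    push_cast
    rfl
  · obtain ⟨n, hn⟩ := (hcop (by lia)).dvd_of_dvd_mul_left hdvd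
    refine not_monogenic_of_pow_eq_one_add (n := -n) (α := -a) (by lia) hK ?_ ?_
    · rw [← hgen]
      refine le_antisymm ?_ ?_ <;> rw [IntermediateField.adjoin_simple_le_iff]
      · simpa using IntermediateField.mem_adjoin_simple_self ℚ (a : K)
      · simpa using neg_mem (IntermediateField.mem_adjoin_simple_self ℚ ((-a : 𝓞 K) : K))
    · rw [Odd.neg_pow (by decide), ha, show m = 81 * n - 1 by lia]
      push_cast
      ring
end

section
/- Let m ≠ 1 be a squarefree rational integer with m ≡ 1 (mod 32), such that F(x) = x^8 − m is irreducible over ℚ. Let α be a complex root of F and K = ℚ(α) be the corresponding octic field. Then K is not monogenic. -/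
open Polynomial NumberField

/-- Hensel lifting: a `2`-adic integer congruent to `1` modulo `32` is the eighth power of a
`2`-adic integer congruent to `1` modulo `4`. -/
lemma exists_one_add_four_mul_pow_eight (k : ℤ_[2]) :
    ∃ t : ℤ_[2], (1 + 4 * t) ^ 8 = 1 + 32 * k := by
  let F : ℤ_[2][X] := X + C 14 * X ^ 2 + C 112 * X ^ 3 + C 560 * X ^ 4 + C 1792 * X ^ 5
    + C 3584 * X ^ 6 + C 4096 * X ^ 7 + C 2048 * X ^ 8 - C k
  have hderiv : ‖F.derivative.aeval k‖ = 1 := by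
    refine le_antisymm (PadicInt.norm_le_one _) (not_lt.mp fun hlt => ?_)
    rw [PadicInt.norm_lt_one_iff_dvd] at hlt
    refine (PadicInt.prime_p (p := 2)).not_dvd_one ((dvd_sub_right hlt).mp ?_)
    refine Dvd.intro (14 * k + 168 * k ^ 2 + 1120 * k ^ 3 + 4480 * k ^ 4 + 10752 * k ^ 5
      + 14336 * k ^ 6 + 8192 * k ^ 7) ?_
    simp [F]
    ring
  have hval : ‖F.aeval k‖ < 1 := by
    rw [PadicInt.norm_lt_one_iff_dvd]
    refine Dvd.intro (7 * k ^ 2 + 56 * k ^ 3 + 280 * k ^ 4 + 896 * k ^ 5 + 1792 * k ^ 6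
      + 2048 * k ^ 7 + 1024 * k ^ 8) ?_
    simp [F]
    ring
  obtain ⟨t, ht, -⟩ := hensels_lemma (F := F) (a := k) (by rw [hderiv]; simpa using hval)
  refine ⟨t, ?_⟩
  simp [F] at ht
  linear_combination 32 * ht

lemma PadicInt.even_of_sq_add_sq_eq_four_mul {a b n : ℤ_[2]} (h : a ^ 2 + b ^ 2 = 4 * n) :
    2 ∣ a := by
  have hp : Prime (2 : ℤ_[2]) := by exact_mod_cast PadicInt.prime_p (p := 2)
  have hab : (2 : ℤ_[2]) ∣ a + b :=
    hp.dvd_of_dvd_pow (n := 2) ⟨2 * n + a * b, by linear_combination h⟩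
  obtain ⟨e, he⟩ := hab
  refine hp.dvd_of_dvd_pow (n := 2) ⟨n + a * e - e ^ 2, ?_⟩
  refine mul_left_cancel₀ hp.ne_zero ?_
  obtain rfl : b = 2 * e - a := by linear_combination he
  linear_combination h

lemma PadicInt.toZMod_two_mul (a : ℤ_[2]) : PadicInt.toZMod (2 * a) = 0 := by
  rw [map_mul, map_ofNat]
  exact zero_mul _

lemma Padic.exists_eq_coe_of_isIntegral {p : ℕ} [Fact p.Prime] {x : ℚ_[p]}
    (hx : IsIntegral ℤ x) : ∃ a : ℤ_[p], x = a := by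
  obtain ⟨a, ha⟩ := IsIntegrallyClosed.isIntegral_iff.mp (hx.tower_top (A := ℤ_[p]))
  exact ⟨a, ha.symm⟩

/-- The field `ℚ₂(i)`. -/
abbrev PadicGaussian : Type := QuadraticAlgebra ℚ_[2] (-1) 0

namespace PadicGaussian

open scoped QuadraticAlgebra

lemma isIntegral_star {x : PadicGaussian} (hx : IsIntegral ℤ x) : IsIntegral ℤ (star x) :=
  hx.map (starRingEnd PadicGaussian).toIntAlgHom

lemma exists_two_mul_re_eq {x : PadicGaussian} (hx : IsIntegral ℤ x) :
    ∃ a : ℤ_[2], 2 * x.re = a := by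
  refine Padic.exists_eq_coe_of_isIntegral
    ((isIntegral_algebraMap_iff (B := PadicGaussian) QuadraticAlgebra.algebraMap_injective).mp ?_)
  convert hx.add (isIntegral_star hx) using 1
  ext <;> simp
  ring

/-- The integral elements of `ℚ₂(i)` lie in `ℤ₂[i]`. -/
lemma exists_eq_mk_of_isIntegral {x : PadicGaussian} (hx : IsIntegral ℤ x) :
    ∃ a b : ℤ_[2], x = ⟨a, b⟩ := by
  have hI : IsIntegral ℤ (⟨0, -1⟩ : PadicGaussian) := by
    refine ⟨X ^ 2 + 1, by monicity!, ?_⟩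
    ext <;> simp [pow_two]
  obtain ⟨a, ha⟩ := exists_two_mul_re_eq hx
  obtain ⟨b, hb⟩ := exists_two_mul_re_eq (hI.mul hx)
  obtain ⟨n, hn⟩ : ∃ n : ℤ_[2], x.re ^ 2 + x.im ^ 2 = n := by
    refine Padic.exists_eq_coe_of_isIntegral
      ((isIntegral_algebraMap_iff (B := PadicGaussian) QuadraticAlgebra.algebraMap_injective).mp ?_)
    convert hx.mul (isIntegral_star hx) using 1
    rw [← QuadraticAlgebra.algebraMap_norm_eq_mul_star, QuadraticAlgebra.norm_def]
    congr 1
    ring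
  simp only [QuadraticAlgebra.re_mul, zero_mul, mul_neg, mul_one, neg_neg, one_mul,
    zero_add] at hb
  have hsum : a ^ 2 + b ^ 2 = 4 * n := by
    have : (a : ℚ_[2]) ^ 2 + b ^ 2 = 4 * n := by
      rw [← ha, ← hb, ← hn]
      ring
    exact Subtype.coe_injective this
  obtain ⟨c, rfl⟩ := PadicInt.even_of_sq_add_sq_eq_four_mul hsum
  obtain ⟨d, rfl⟩ := PadicInt.even_of_sq_add_sq_eq_four_mul ((add_comm _ _).trans hsum)
  push_cast at ha hb
  refine ⟨c, d, ?_⟩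
  ext
  · exact mul_left_cancel₀ two_ne_zero ha
  · exact mul_left_cancel₀ two_ne_zero hb

/-- `h` is the embedding `φ` of `K` into `ℚ₂(i)` followed by reduction modulo `1 + i`. -/
def IsResidueHom {K : Type*} [Field K] (φ : K →+* PadicGaussian) (h : 𝓞 K →+* ZMod 2) : Prop :=
  ∀ (x : 𝓞 K) (a b : ℤ_[2]), φ x = ⟨a, b⟩ → h x = PadicInt.toZMod (a + b)

lemma exists_isResidueHom {K : Type*} [Field K] (φ : K →+* PadicGaussian) :
    ∃ h : 𝓞 K →+* ZMod 2, IsResidueHom φ h := by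
  have key : ∀ x : 𝓞 K, ∃ a b : ℤ_[2], φ x = ⟨a, b⟩ := fun x =>
    exists_eq_mk_of_isIntegral (x.isIntegral_coe.map φ.toIntAlgHom)
  choose a b hab using key
  have huniq : ∀ (x : 𝓞 K) (c d : ℤ_[2]), φ x = ⟨c, d⟩ → a x = c ∧ b x = d := by
    intro x c d hx
    rw [hab x, QuadraticAlgebra.mk.injEq] at hx
    exact ⟨Subtype.coe_injective hx.1, Subtype.coe_injective hx.2⟩
  have hone := huniq 1 1 0 (by ext <;> simp)
  have hzero := huniq 0 0 0 (by ext <;> simp)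
  have hadd : ∀ x y, a (x + y) = a x + a y ∧ b (x + y) = b x + b y := fun x y =>
    huniq _ _ _ (by ext <;> simp [hab])
  have hmul : ∀ x y, a (x * y) = a x * a y - b x * b y ∧ b (x * y) = a x * b y + b x * a y :=
    fun x y => huniq _ _ _ (by ext <;> simp [hab]; ring)
  have two_eq : (2 : ZMod 2) = 0 := rfl
  refine ⟨{ toFun := fun x => PadicInt.toZMod (a x + b x), map_one' := ?_, map_mul' := ?_,
            map_zero' := ?_, map_add' := ?_ }, ?_⟩
  · simp [hone]
  · intro x y
    simp only [hmul, map_add, map_sub, map_mul]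
    linear_combination (-PadicInt.toZMod (b x) * PadicInt.toZMod (b y)) * two_eq
  · simp [hzero]
  · intro x y
    simp only [hadd, map_add]
    ring
  · intro x c d hx
    obtain ⟨rfl, rfl⟩ := huniq x c d hx
    rfl

lemma mul_left_cancel_eight {x y : PadicGaussian} (h : 8 * x = 8 * y) : x = y := by
  have h8 : (8 : ℚ_[2]) ≠ 0 := by norm_num
  rw [QuadraticAlgebra.ext_iff] at h ⊢
  simpa [h8] using h

section Values

variable {K : Type*} [Field K] {φ : K →+* PadicGaussian} {h : 𝓞 K →+* ZMod 2} {α : K} {y : 𝓞 K}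

lemma IsResidueHom.apply_eq_of_re (hh : IsResidueHom φ h)
    (hy : 8 * (y : K) = (1 + α) * (1 + α ^ 2) * (1 + α ^ 4))
    {u a : ℤ_[2]} (hα : φ α = ⟨u, 0⟩) (ha : 8 * a = (1 + u) * (1 + u ^ 2) * (1 + u ^ 4)) :
    h y = PadicInt.toZMod a := by
  have ha' : (8 : ℚ_[2]) * a = (1 + u) * (1 + u ^ 2) * (1 + u ^ 4) :=
    congrArg (fun x : ℤ_[2] => (x : ℚ_[2])) ha
  rw [← add_zero a]
  refine hh y a 0 (mul_left_cancel_eight ?_)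
  have := congrArg φ hy
  simp only [map_mul, map_add, map_pow, map_one, map_ofNat, hα] at this
  rw [this]
  ext
  · simp [pow_succ]
    linear_combination -ha'
  · simp [pow_succ]

lemma IsResidueHom.apply_eq_of_im (hh : IsResidueHom φ h)
    (hy : 8 * (y : K) = (1 + α) * (1 + α ^ 2) * (1 + α ^ 4))
    {v a : ℤ_[2]} (hα : φ α = ⟨0, v⟩) (ha : 8 * a = (1 - v ^ 2) * (1 + v ^ 4)) :
    h y = PadicInt.toZMod (a * (1 + v)) := by
  have ha' : (8 : ℚ_[2]) * a = (1 - v ^ 2) * (1 + v ^ 4) :=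
    congrArg (fun x : ℤ_[2] => (x : ℚ_[2])) ha
  rw [mul_add, mul_one]
  refine hh y a (a * v) (mul_left_cancel_eight ?_)
  have := congrArg φ hy
  simp only [map_mul, map_add, map_pow, map_one, map_ofNat, hα] at this
  rw [this]
  ext
  · simp [pow_succ]
    linear_combination -ha'
  · simp [pow_succ]
    linear_combination (-v : ℚ_[2]) * ha'

variable {t : ℤ_[2]}

lemma IsResidueHom.apply_eq_one (hh : IsResidueHom φ h)
    (hy : 8 * (y : K) = (1 + α) * (1 + α ^ 2) * (1 + α ^ 4))
    (hα : φ α = ⟨(1 + 4 * t : ℤ_[2]), 0⟩) : h y = 1 := by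
  rw [hh.apply_eq_of_re hy hα (a := 1 + 2 * (t + (1 + 2 * t) * (2 * t + 4 * t ^ 2
      + (1 + 4 * t + 8 * t ^ 2) * (4 * t + 24 * t ^ 2 + 64 * t ^ 3 + 64 * t ^ 4)))) (by ring),
    map_add, map_one, PadicInt.toZMod_two_mul, add_zero]

lemma IsResidueHom.apply_eq_zero_of_re (hh : IsResidueHom φ h)
    (hy : 8 * (y : K) = (1 + α) * (1 + α ^ 2) * (1 + α ^ 4))
    (hα : φ α = ⟨(-(1 + 4 * t) : ℤ_[2]), 0⟩) : h y = 0 := by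
  rw [hh.apply_eq_of_re hy hα (a := 2 * (-t * (1 + 4 * t + 8 * t ^ 2)
      * (1 + 8 * t + 48 * t ^ 2 + 128 * t ^ 3 + 128 * t ^ 4))) (by ring),
    PadicInt.toZMod_two_mul]

lemma IsResidueHom.apply_eq_zero_of_im (hh : IsResidueHom φ h)
    (hy : 8 * (y : K) = (1 + α) * (1 + α ^ 2) * (1 + α ^ 4)) {v : ℤ_[2]}
    (hv : v ^ 2 = (1 + 4 * t) ^ 2) (hα : φ α = ⟨0, v⟩) : h y = 0 := by
  have hv4 : v ^ 4 = (1 + 4 * t) ^ 4 := by linear_combination (v ^ 2 + (1 + 4 * t) ^ 2) * hv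
  rw [hh.apply_eq_of_im hy hα (a := 2 * (-t * (1 + 2 * t)
      * (1 + 8 * t + 48 * t ^ 2 + 128 * t ^ 3 + 128 * t ^ 4))) (by rw [hv, hv4]; ring),
    mul_assoc, PadicInt.toZMod_two_mul]

end Values

end PadicGaussian

/-- The algebraic integer `(1 + α + ⋯ + α ^ 7) / 8`. -/
lemma exists_integer_eight_mul_eq {K : Type*} [Field K] [CharZero K] {k : ℤ} (hk : k ≠ 0) {α : K}
    (hα : α ^ 8 = 1 + 32 * k) : ∃ y : 𝓞 K, 8 * (y : K) = (1 + α) * (1 + α ^ 2) * (1 + α ^ 4) := by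
  set y : K := (1 + α) * (1 + α ^ 2) * (1 + α ^ 4) / 8 with hy
  have hyα : y * α = y + 4 * k := by rw [hy]; linear_combination hα / 8
  have hpow : (y + 4 * k) ^ 8 = (1 + 32 * k) * y ^ 8 := by rw [← hyα, mul_pow, hα, mul_comm]
  have hint : IsIntegral ℤ y := by
    refine ⟨X ^ 8 - X ^ 7 - C (14 * k) * X ^ 6 - C (112 * k ^ 2) * X ^ 5 - C (560 * k ^ 3) * X ^ 4
      - C (1792 * k ^ 4) * X ^ 3 - C (3584 * k ^ 5) * X ^ 2 - C (4096 * k ^ 6) * X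
      - C (2048 * k ^ 7), by monicity!, ?_⟩
    have hk' : (32 * k : K) ≠ 0 := mul_ne_zero (by norm_num) (Int.cast_ne_zero.mpr hk)
    refine mul_left_cancel₀ hk' ?_
    simp only [eval₂_sub, eval₂_mul, eval₂_pow, eval₂_X, eval₂_C, algebraMap_int_eq,
      Int.coe_castRingHom, Int.cast_mul, Int.cast_pow, Int.cast_ofNat]
    linear_combination -hpow
  exact ⟨⟨y, hint⟩, by change 8 * y = _; rw [hy]; ring⟩

/-- `K = F(α)` maps to any `F`-algebra in which the minimal polynomial of `α` has a root. -/
lemma exists_algHom_apply_eq {F K L : Type*} [Field F] [Field K] [Algebra F K] [CommRing L]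
    [Algebra F L] {α : K} (hα : IsIntegral F α) (hgen : IntermediateField.adjoin F {α} = ⊤) {x : L}
    (hx : aeval x (minpoly F α) = 0) : ∃ φ : K →ₐ[F] L, φ α = x := by
  have htop : Algebra.adjoin F {α} = ⊤ := by
    rw [← IntermediateField.adjoin_simple_toSubalgebra_of_isAlgebraic hα.isAlgebraic, hgen]
    rfl
  let pb := PowerBasis.ofAdjoinEqTop' hα htop
  have hpb : pb.gen = α := PowerBasis.ofAdjoinEqTop'_gen hα htop
  refine ⟨pb.lift x (by rwa [hpb]), ?_⟩
  simpa only [hpb] using pb.lift_gen x (by rwa [hpb])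

/-- A ring generated by one element over `ℤ` has at most two ring homomorphisms to `ZMod 2`. -/
lemma eq_or_eq_or_eq_of_adjoin_singleton_eq_top {R : Type*} [CommRing R] {θ : R}
    (hθ : Algebra.adjoin ℤ {θ} = ⊤) (f g h : R →+* ZMod 2) : f = g ∨ f = h ∨ g = h := by
  have ext_gen : ∀ f g : R →+* ZMod 2, f θ = g θ → f = g := by
    intro f g hfg
    have := AlgHom.ext_of_adjoin_eq_top hθ (φ₁ := f.toIntAlgHom) (φ₂ := g.toIntAlgHom)
      (by simpa using hfg)
    ext x
    exact DFunLike.congr_fun this x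
  have pigeonhole : ∀ a b c : ZMod 2, a = b ∨ a = c ∨ b = c := by decide
  exact (pigeonhole (f θ) (g θ) (h θ)).imp (ext_gen f g) (Or.imp (ext_gen f h) (ext_gen g h))

/-- If `m ≠ 1` is squarefree with `m ≡ 1 (mod 32)` and `x^8 - m` is irreducible
over `ℚ`, then the octic field `K = ℚ(α)` is not monogenic, where `α` is a root. -/
theorem pure_octic_field_not_monogenic
    (m : ℤ) (hm : Squarefree m) (hm1 : m ≠ 1) (hmod : m ≡ 1 [ZMOD 32])
    (hF : Irreducible ((X : ℚ[X]) ^ 8 - C (m : ℚ)))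
    (K : Type*) [Field K] [NumberField K] (α : K)
    (hgen : IntermediateField.adjoin ℚ {α} = ⊤)
    (hroot : α ^ 8 = (m : K)) :
    ¬ ∃ θ : 𝓞 K, Algebra.adjoin ℤ {θ} = ⊤ := by
  rintro ⟨θ, hθ⟩
  obtain ⟨k, hk⟩ := hmod.symm.dvd
  obtain rfl : m = 1 + 32 * k := by linear_combination hk
  have hk0 : k ≠ 0 := by rintro rfl; exact hm1 (by simp)
  push_cast at hroot
  obtain ⟨t, ht⟩ := exists_one_add_four_mul_pow_eight (k : ℤ_[2])
  have ht' : (1 + 4 * (t : ℚ_[2])) ^ 8 = 1 + 32 * k := by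
    have := congrArg (fun x : ℤ_[2] => (x : ℚ_[2])) ht
    push_cast at this
    exact this
  have hminpoly : minpoly ℚ α = X ^ 8 - C ((1 + 32 * k : ℤ) : ℚ) :=
    (minpoly.eq_of_irreducible_of_monic hF (by simp [hroot]) (by monicity!)).symm
  have exists_hom : ∀ u v : ℤ_[2], (⟨u, v⟩ : PadicGaussian) ^ 8 = ⟨(1 + 4 * t) ^ 8, 0⟩ →
      ∃ (φ : K →+* PadicGaussian) (h : 𝓞 K →+* ZMod 2),
        PadicGaussian.IsResidueHom φ h ∧ φ α = ⟨u, v⟩ := by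
    intro u v huv
    obtain ⟨φ, hφ⟩ : ∃ φ : K →ₐ[ℚ] PadicGaussian, φ α = ⟨u, v⟩ := by
      refine exists_algHom_apply_eq (Algebra.IsIntegral.isIntegral α) hgen ?_
      rw [hminpoly, map_sub, map_pow, aeval_X, aeval_C, huv, ht', map_intCast, sub_eq_zero]
      ext <;> simp only [QuadraticAlgebra.re_intCast, QuadraticAlgebra.im_intCast]
      push_cast
      rfl
    obtain ⟨h, hh⟩ := PadicGaussian.exists_isResidueHom φ.toRingHom
    exact ⟨φ.toRingHom, h, hh, hφ⟩
  have coe_four : ((4 : ℤ_[2]) : ℚ_[2]) = 4 := rfl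
  obtain ⟨φ₁, h₁, hh₁, hφ₁⟩ := exists_hom (1 + 4 * t) 0 (by
    ext <;> simp [pow_succ, coe_four])
  obtain ⟨φ₂, h₂, hh₂, hφ₂⟩ := exists_hom (-(1 + 4 * t)) 0 (by
    ext <;> simp [pow_succ, coe_four]; ring)
  obtain ⟨φ₃, h₃, hh₃, hφ₃⟩ := exists_hom 0 (1 + 4 * t) (by
    ext <;> simp [pow_succ, coe_four]; ring)
  obtain ⟨y, hy⟩ := exists_integer_eight_mul_eq hk0 hroot
  obtain ⟨z, hz⟩ := exists_integer_eight_mul_eq (α := -α) hk0 (by linear_combination hroot)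
  have h₁y : h₁ y = 1 := hh₁.apply_eq_one hy hφ₁
  have h₂y : h₂ y = 0 := hh₂.apply_eq_zero_of_re hy hφ₂
  have h₃y : h₃ y = 0 := hh₃.apply_eq_zero_of_im hy rfl hφ₃
  have h₂z : h₂ z = 1 := hh₂.apply_eq_one (t := t) hz (by rw [map_neg, hφ₂]; ext <;> simp)
  have h₃z : h₃ z = 0 := hh₃.apply_eq_zero_of_im (t := t) (v := -(1 + 4 * t)) hz (by ring)
    (by rw [map_neg, hφ₃]; ext <;> simp)
  rcases eq_or_eq_or_eq_of_adjoin_singleton_eq_top hθ h₁ h₂ h₃ with rfl | rfl | rfl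
  · exact one_ne_zero (h₁y.symm.trans h₂y)
  · exact one_ne_zero (h₁y.symm.trans h₃y)
  · exact one_ne_zero (h₂z.symm.trans h₃z)
end
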